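/- arXiv:1709.07115 — 9 statements merged into one kernel-verified Lean document; each statement's English description precedes it below -/
import Mathlib

section
/- Assume G ∈ L¹(D × D) and that λ > 0 is large enough that K_λ is nonempty (it suffices that λπδ² ≥ max(|κ₁|, |κ₂|)). Then the supremum of the energy E over K_λ is finite (indeed E(ω) ≤ (λ²/2)∫_D∫_D |G(x,y)| dx dy for every ω ∈ K_λ) and it is attained: there exists ω^λ ∈ K_λ with E(ω^λ) = sup_{ω ∈ K_λ} E(ω). -/
open MeasureTheory Metric Set Filter Topology Real

noncomputable section

abbrev Pt : Type := EuclideanSpace ℝ (Fin 2)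

/-- The pair of vorticity components `(ω₁, ω₂)` is admissible: `0 ≤ ω₁ ≤ λ`,
`-λ ≤ ω₂ ≤ 0` a.e. on `D`, prescribed integrals, supports in `B₁`, `B₂`. -/
def IsAdmissiblePair (D B1 B2 : Set Pt) (κ1 κ2 lam : ℝ) (ω1 ω2 : Pt → ℝ) : Prop :=
  Measurable ω1 ∧ Measurable ω2 ∧
  (∀ᵐ x ∂(volume.restrict D), 0 ≤ ω1 x ∧ ω1 x ≤ lam) ∧
  (∀ᵐ x ∂(volume.restrict D), -lam ≤ ω2 x ∧ ω2 x ≤ 0) ∧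
  (∫ x in D, ω1 x) = κ1 ∧ (∫ x in D, ω2 x) = κ2 ∧
  (∀ᵐ x ∂(volume.restrict D), x ∉ B1 → ω1 x = 0) ∧
  (∀ᵐ x ∂(volume.restrict D), x ∉ B2 → ω2 x = 0)

/-- Membership in the admissible class `K_λ`. -/
def InK (D B1 B2 : Set Pt) (κ1 κ2 lam : ℝ) (ω : Pt → ℝ) : Prop :=
  ∃ ω1 ω2 : Pt → ℝ, ω =ᵐ[volume.restrict D] ω1 + ω2 ∧
    IsAdmissiblePair D B1 B2 κ1 κ2 lam ω1 ω2

/-- The kinetic energy associated with a kernel `G`. -/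
def energy (D : Set Pt) (G : Pt → Pt → ℝ) (ω : Pt → ℝ) : ℝ :=
  (1 / 2) * ∫ x in D, ∫ y in D, G x y * ω x * ω y

lemma ae_prod_norm_mul_le {α : Type*} [MeasurableSpace α] {μ : Measure α} {f : α → ℝ} {C : ℝ}
    (hb : ∀ᵐ x ∂μ, |f x| ≤ C) :
    ∀ᵐ p ∂(μ.prod μ), ‖f p.1 * f p.2‖ ≤ C ^ 2 := by
  filter_upwards [Measure.quasiMeasurePreserving_fst.ae hb,
    Measure.quasiMeasurePreserving_snd.ae hb] with p h1 h2
  rw [norm_mul, sq]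
  exact mul_le_mul h1 h2 (norm_nonneg _) ((abs_nonneg _).trans h1)

lemma aestronglyMeasurable_tensor_self {α : Type*} [MeasurableSpace α] {μ : Measure α}
    [SFinite μ] {f : α → ℝ} (hf : AEStronglyMeasurable f μ) :
    AEStronglyMeasurable (fun p : α × α => f p.1 * f p.2) (μ.prod μ) :=
  hf.comp_fst.mul hf.comp_snd

lemma integrable_mul_tensor_self {α : Type*} [MeasurableSpace α] {μ : Measure α}
    [SFinite μ] {f : α → ℝ} {C : ℝ} (hf : AEStronglyMeasurable f μ)
    (hb : ∀ᵐ x ∂μ, |f x| ≤ C) {H : α × α → ℝ} (hH : Integrable H (μ.prod μ)) :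
    Integrable (fun p => H p * (f p.1 * f p.2)) (μ.prod μ) :=
  hH.mul_bdd (aestronglyMeasurable_tensor_self hf) (ae_prod_norm_mul_le hb)

lemma abs_integral_mul_tensor_self_le {α : Type*} [MeasurableSpace α] {μ : Measure α}
    {f : α → ℝ} {C : ℝ} (hb : ∀ᵐ x ∂μ, |f x| ≤ C) {H : α × α → ℝ}
    (hH : Integrable H (μ.prod μ)) :
    |∫ p, H p * (f p.1 * f p.2) ∂(μ.prod μ)| ≤ C ^ 2 * ∫ p, |H p| ∂(μ.prod μ) := by
  rw [← integral_const_mul, ← Real.norm_eq_abs]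
  refine norm_integral_le_of_norm_le (hH.abs.const_mul _) ?_
  filter_upwards [ae_prod_norm_mul_le hb] with p hp
  rw [norm_mul, mul_comm]
  exact mul_le_mul_of_nonneg_right hp (norm_nonneg _)

/-- For a uniformly bounded family `F t` whose set integrals depend continuously on `t`, the
integrals of `F t ⊗ F t` over measurable sets depend continuously on `t`. -/
lemma continuous_setIntegral_tensor_self {α T : Type*} [MeasurableSpace α] [TopologicalSpace T]
    {μ : Measure α} [IsFiniteMeasure μ] {F : T → α → ℝ} {C : ℝ}
    (hF : ∀ t, AEStronglyMeasurable (F t) μ) (hb : ∀ t, ∀ᵐ x ∂μ, |F t x| ≤ C)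
    (hc : ∀ s, MeasurableSet s → Continuous fun t => ∫ x in s, F t x ∂μ)
    {S : Set (α × α)} (hS : MeasurableSet S) :
    Continuous fun t => ∫ p in S, F t p.1 * F t p.2 ∂(μ.prod μ) := by
  have hrect : ∀ s u, MeasurableSet s → MeasurableSet u →
      Continuous fun t => ∫ p in s ×ˢ u, F t p.1 * F t p.2 ∂(μ.prod μ) := by
    intro s u hs hu
    simp_rw [setIntegral_prod_mul]
    exact (hc s hs).mul (hc u hu)
  have hint : ∀ t, Integrable (fun p : α × α => F t p.1 * F t p.2) (μ.prod μ) := fun t =>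
    .of_bound (aestronglyMeasurable_tensor_self (hF t)) _ (ae_prod_norm_mul_le (hb t))
  induction S, hS using MeasurableSpace.induction_on_inter generateFrom_prod.symm
    isPiSystem_prod with
  | empty => simpa using continuous_const
  | basic S hS =>
    obtain ⟨s, hs, u, hu, rfl⟩ := hS
    exact hrect s u hs hu
  | compl S hS ih =>
    simp_rw [fun t => setIntegral_compl hS (hint t)]
    refine Continuous.sub ?_ ih
    simpa using hrect univ univ .univ .univ
  | iUnion S hd hS ih =>
    simp_rw [fun t => (hasSum_integral_iUnion hS hd (hint t).integrableOn).tsum_eq.symm]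
    refine continuous_tsum ih ((summable_measure_toReal (μ := μ.prod μ) hS hd).mul_left (C ^ 2)) fun n t => ?_
    exact norm_setIntegral_le_of_norm_le_const_ae (measure_lt_top _ _)
      (ae_restrict_of_ae (ae_prod_norm_mul_le (hb t)))

/-- For a uniformly bounded family `F t` whose set integrals depend continuously on `t`, the
quadratic form with integrable kernel `H` evaluated at `F t` depends continuously on `t`. -/
lemma continuous_integral_mul_tensor_self {α T : Type*} [MeasurableSpace α] [TopologicalSpace T]
    {μ : Measure α} [IsFiniteMeasure μ] {F : T → α → ℝ} {C : ℝ}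
    (hF : ∀ t, AEStronglyMeasurable (F t) μ) (hb : ∀ t, ∀ᵐ x ∂μ, |F t x| ≤ C)
    (hc : ∀ s, MeasurableSet s → Continuous fun t => ∫ x in s, F t x ∂μ)
    {H : α × α → ℝ} (hH : Integrable H (μ.prod μ)) :
    Continuous fun t => ∫ p, H p * (F t p.1 * F t p.2) ∂(μ.prod μ) := by
  refine Integrable.induction
    (fun H => Continuous fun t => ∫ p, H p * (F t p.1 * F t p.2) ∂(μ.prod μ)) ?_ ?_ ?_ ?_ hH
  · intro c S hS _
    have h : ∀ t, ∫ p, S.indicator (fun _ => c) p * (F t p.1 * F t p.2) ∂(μ.prod μ)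
        = c * ∫ p in S, F t p.1 * F t p.2 ∂(μ.prod μ) := by
      intro t
      rw [← integral_const_mul, ← integral_indicator hS]
      congr 1 with p
      by_cases hp : p ∈ S <;> simp [hp]
    simp_rw [h]
    exact (continuous_setIntegral_tensor_self hF hb hc hS).const_mul c
  · intro f g _ hf hg ihf ihg
    have h : ∀ t, ∫ p, (f + g) p * (F t p.1 * F t p.2) ∂(μ.prod μ)
        = (∫ p, f p * (F t p.1 * F t p.2) ∂(μ.prod μ))
          + ∫ p, g p * (F t p.1 * F t p.2) ∂(μ.prod μ) := by
      intro t
      simp_rw [Pi.add_apply, add_mul]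
      exact integral_add (integrable_mul_tensor_self (hF t) (hb t) hf)
        (integrable_mul_tensor_self (hF t) (hb t) hg)
    simp_rw [h]
    exact ihf.add ihg
  · refine isClosed_of_closure_subset fun f hf => ?_
    refine continuous_of_uniform_approx_of_continuous fun u hu => ?_
    obtain ⟨ε, hε, hεu⟩ := Metric.mem_uniformity_dist.1 hu
    obtain ⟨g, hg, hfg⟩ := Metric.mem_closure_iff.1 hf (ε / (C ^ 2 + 1)) (by positivity)
    refine ⟨_, hg, fun t => hεu ?_⟩
    have hf1 := L1.integrable_coeFn f
    have hg1 := L1.integrable_coeFn g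
    rw [Real.dist_eq, ← integral_sub (integrable_mul_tensor_self (hF t) (hb t) hf1)
      (integrable_mul_tensor_self (hF t) (hb t) hg1)]
    simp_rw [← sub_mul]
    refine (abs_integral_mul_tensor_self_le (hb t) (hf1.sub hg1)).trans_lt ?_
    rw [L1.dist_eq_integral_dist] at hfg
    calc C ^ 2 * ∫ p, |f p - g p| ∂(μ.prod μ)
        ≤ (C ^ 2 + 1) * ∫ p, |f p - g p| ∂(μ.prod μ) :=
          mul_le_mul_of_nonneg_right (by linarith) (integral_nonneg fun _ => abs_nonneg _)
      _ < ε := by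
          rw [mul_comm]
          exact (lt_div_iff₀ (by positivity)).1 hfg
  · intro f g hfg hf ih
    refine ih.congr fun t => integral_congr_ae ?_
    filter_upwards [hfg] with p hp
    rw [hp]

/-- `f` satisfies `a ≤ f ≤ b` almost everywhere and has integral `κ i` over each `S i`. -/
def IsBoxConstrained {α ι : Type*} [MeasurableSpace α] (μ : Measure α) (a b : α → ℝ)
    (S : ι → Set α) (κ : ι → ℝ) (f : α → ℝ) : Prop :=
  AEStronglyMeasurable f μ ∧ (∀ᵐ x ∂μ, a x ≤ f x ∧ f x ≤ b x) ∧ ∀ i, ∫ x in S i, f x ∂μ = κ i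

/-- The functionals on `L²` that represent box-constrained functions. -/
def boxFunctionals {α ι : Type*} [MeasurableSpace α] (μ : Measure α) [IsFiniteMeasure μ]
    (a b : α → ℝ) {S : ι → Set α} (hS : ∀ i, MeasurableSet (S i)) (κ : ι → ℝ) (C : ℝ) :
    Set (WeakDual ℝ (Lp ℝ 2 μ)) :=
  (WeakDual.toStrongDual ⁻¹' closedBall 0 ‖indicatorConstLp 2 .univ (measure_ne_top μ _) C‖) ∩
    ({φ | ∀ s (hs : MeasurableSet s),
      φ (indicatorConstLp 2 hs (measure_ne_top μ s) 1) ∈ Icc (∫ x in s, a x ∂μ) (∫ x in s, b x ∂μ)}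
      ∩ {φ | ∀ i, φ (indicatorConstLp 2 (hS i) (measure_ne_top μ _) 1) = κ i})

lemma isCompact_boxFunctionals {α ι : Type*} [MeasurableSpace α] (μ : Measure α)
    [IsFiniteMeasure μ] (a b : α → ℝ) {S : ι → Set α} (hS : ∀ i, MeasurableSet (S i))
    (κ : ι → ℝ) (C : ℝ) : IsCompact (boxFunctionals μ a b hS κ C) := by
  refine (WeakDual.isCompact_closedBall _ _).inter_right (.inter ?_ ?_)
  · simp_rw [ofPred_forall]
    exact isClosed_iInter fun s => isClosed_iInter fun hs =>
      isClosed_Icc.preimage (WeakDual.eval_continuous _)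
  · simp_rw [ofPred_forall]
    exact isClosed_iInter fun i => isClosed_eq (WeakDual.eval_continuous _) continuous_const

/-- The `L²` function representing a functional. -/
def rieszRep {α : Type*} [MeasurableSpace α] {μ : Measure α} (φ : WeakDual ℝ (Lp ℝ 2 μ)) :
    Lp ℝ 2 μ :=
  (InnerProductSpace.toDual ℝ (Lp ℝ 2 μ)).symm (WeakDual.toStrongDual φ)

lemma setIntegral_rieszRep {α : Type*} [MeasurableSpace α] {μ : Measure α} [IsFiniteMeasure μ]
    (φ : WeakDual ℝ (Lp ℝ 2 μ)) {s : Set α} (hs : MeasurableSet s) :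
    ∫ x in s, rieszRep φ x ∂μ = φ (indicatorConstLp 2 hs (measure_ne_top μ s) 1) := by
  rw [← L2.inner_indicatorConstLp_one (𝕜 := ℝ) hs (measure_ne_top μ s), real_inner_comm]
  exact InnerProductSpace.toDual_symm_apply

lemma isBoxConstrained_rieszRep {α ι : Type*} [MeasurableSpace α] {μ : Measure α}
    [IsFiniteMeasure μ] {a b : α → ℝ} (ha : Integrable a μ) (hb : Integrable b μ)
    {S : ι → Set α} (hS : ∀ i, MeasurableSet (S i)) {κ : ι → ℝ} {C : ℝ}
    {φ : WeakDual ℝ (Lp ℝ 2 μ)} (hφ : φ ∈ boxFunctionals μ a b hS κ C) :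
    IsBoxConstrained μ a b S κ (rieszRep φ) := by
  obtain ⟨-, hbox, hκ⟩ := hφ
  have hint : Integrable (rieszRep φ) μ := (Lp.memLp (rieszRep φ)).integrable (by norm_num)
  refine ⟨hint.1, ?_, fun i => (setIntegral_rieszRep φ (hS i)).trans (hκ i)⟩
  have h1 : a ≤ᵐ[μ] rieszRep φ := ae_le_of_forall_setIntegral_le ha hint fun s hs _ => by
    rw [setIntegral_rieszRep φ hs]
    exact (hbox s hs).1
  have h2 : rieszRep φ ≤ᵐ[μ] b := ae_le_of_forall_setIntegral_le hint hb fun s hs _ => by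
    rw [setIntegral_rieszRep φ hs]
    exact (hbox s hs).2
  exact h1.and h2

lemma IsBoxConstrained.ae_abs_le {α ι : Type*} [MeasurableSpace α] {μ : Measure α}
    {a b f : α → ℝ} {S : ι → Set α} {κ : ι → ℝ} {C : ℝ} (hf : IsBoxConstrained μ a b S κ f)
    (haC : ∀ x, -C ≤ a x) (hbC : ∀ x, b x ≤ C) : ∀ᵐ x ∂μ, |f x| ≤ C := by
  filter_upwards [hf.2.1] with x hx
  exact abs_le.2 ⟨(haC x).trans hx.1, hx.2.trans (hbC x)⟩

lemma IsBoxConstrained.exists_mem_boxFunctionals {α ι : Type*} [MeasurableSpace α]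
    {μ : Measure α} [IsFiniteMeasure μ] {a b f : α → ℝ} (ha : Integrable a μ)
    (hb : Integrable b μ) {S : ι → Set α} (hS : ∀ i, MeasurableSet (S i)) {κ : ι → ℝ} {C : ℝ}
    (hf : IsBoxConstrained μ a b S κ f) (haC : ∀ x, -C ≤ a x) (hbC : ∀ x, b x ≤ C) :
    ∃ φ ∈ boxFunctionals μ a b hS κ C, rieszRep φ =ᵐ[μ] f := by
  have hfC := hf.ae_abs_le haC hbC
  have hfL : MemLp f 2 μ := .of_bound hf.1 C hfC
  have hfi : Integrable f μ := hfL.integrable (by norm_num)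
  let φ : WeakDual ℝ (Lp ℝ 2 μ) := StrongDual.toWeakDual (InnerProductSpace.toDual ℝ _ hfL.toLp)
  have hrep : rieszRep φ = hfL.toLp :=
    (InnerProductSpace.toDual ℝ (Lp ℝ 2 μ)).symm_apply_apply _
  have hae : rieszRep φ =ᵐ[μ] f := hrep ▸ hfL.coeFn_toLp
  have hval : ∀ s (hs : MeasurableSet s),
      φ (indicatorConstLp 2 hs (measure_ne_top μ s) 1) = ∫ x in s, f x ∂μ := fun s hs => by
    rw [← setIntegral_rieszRep φ hs]
    exact integral_congr_ae (ae_restrict_of_ae hae)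
  refine ⟨φ, ⟨?_, fun s hs => ?_, fun i => (hval _ (hS i)).trans (hf.2.2 i)⟩, hae⟩
  · have hnorm : ‖WeakDual.toStrongDual φ‖ = ‖hfL.toLp‖ :=
      (InnerProductSpace.toDual ℝ (Lp ℝ 2 μ)).norm_map _
    rw [mem_preimage, mem_closedBall_zero_iff, hnorm]
    refine Lp.norm_le_norm_of_ae_le ?_
    filter_upwards [hfL.coeFn_toLp, hfC,
      indicatorConstLp_coeFn (p := 2) (hs := .univ) (hμs := measure_ne_top μ univ) (c := C)]
      with x h1 h2 h3
    rw [h1, h3, indicator_univ]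
    exact h2.trans (le_abs_self C)
  · rw [hval s hs]
    exact ⟨setIntegral_mono_ae ha.integrableOn hfi.integrableOn (hf.2.1.mono fun _ h => h.1),
      setIntegral_mono_ae hfi.integrableOn hb.integrableOn (hf.2.1.mono fun _ h => h.2)⟩

/-- A quadratic form with integrable kernel attains its maximum over a nonempty class of
box-constrained functions. -/
theorem exists_isBoxConstrained_forall_integral_le {α ι : Type*} [MeasurableSpace α]
    {μ : Measure α} [IsFiniteMeasure μ] {a b : α → ℝ} (ha : Integrable a μ)
    (hb : Integrable b μ) {S : ι → Set α} (hS : ∀ i, MeasurableSet (S i)) {κ : ι → ℝ} {C : ℝ}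
    (haC : ∀ x, -C ≤ a x) (hbC : ∀ x, b x ≤ C) {H : α × α → ℝ} (hH : Integrable H (μ.prod μ))
    (hne : ∃ f, IsBoxConstrained μ a b S κ f) :
    ∃ f, Measurable f ∧ IsBoxConstrained μ a b S κ f ∧ ∀ g, IsBoxConstrained μ a b S κ g →
      ∫ p, H p * (g p.1 * g p.2) ∂(μ.prod μ) ≤ ∫ p, H p * (f p.1 * f p.2) ∂(μ.prod μ) := by
  have : CompactSpace (boxFunctionals μ a b hS κ C) :=
    isCompact_iff_compactSpace.1 (isCompact_boxFunctionals μ a b hS κ C)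
  obtain ⟨f₀, hf₀⟩ := hne
  obtain ⟨φ₀, hφ₀, -⟩ := hf₀.exists_mem_boxFunctionals ha hb hS haC hbC
  have : Nonempty (boxFunctionals μ a b hS κ C) := ⟨⟨φ₀, hφ₀⟩⟩
  have hbox (φ : boxFunctionals μ a b hS κ C) : IsBoxConstrained μ a b S κ (rieszRep φ.1) :=
    isBoxConstrained_rieszRep ha hb hS φ.2
  have hcont : Continuous fun φ : boxFunctionals μ a b hS κ C =>
      ∫ p, H p * (rieszRep φ.1 p.1 * rieszRep φ.1 p.2) ∂(μ.prod μ) := by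
    refine continuous_integral_mul_tensor_self (F := fun φ : boxFunctionals μ a b hS κ C =>
      ⇑(rieszRep φ.1)) (fun φ => (hbox φ).1) (fun φ => (hbox φ).ae_abs_le haC hbC)
      (fun s hs => ?_) hH
    simp_rw [setIntegral_rieszRep _ hs]
    exact (WeakDual.eval_continuous _).comp continuous_subtype_val
  obtain ⟨φ, -, hφ⟩ := isCompact_univ.exists_isMaxOn univ_nonempty hcont.continuousOn
  refine ⟨rieszRep φ.1, (Lp.stronglyMeasurable _).measurable, hbox φ, fun g hg => ?_⟩
  obtain ⟨ψ, hψ, hψg⟩ := hg.exists_mem_boxFunctionals ha hb hS haC hbC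
  refine le_of_eq_of_le (integral_congr_ae ?_) (hφ (mem_univ ⟨ψ, hψ⟩))
  filter_upwards [Measure.quasiMeasurePreserving_fst.ae hψg,
    Measure.quasiMeasurePreserving_snd.ae hψg] with p h1 h2
  rw [h1, h2]

lemma InK.isBoxConstrained {D B1 B2 : Set Pt} {κ1 κ2 lam : ℝ} {ω : Pt → ℝ}
    (hB1 : MeasurableSet B1) (hB2 : MeasurableSet B2) (hd : Disjoint B1 B2)
    (hω : InK D B1 B2 κ1 κ2 lam ω) :
    IsBoxConstrained (volume.restrict D) (B2.indicator fun _ => -lam) (B1.indicator fun _ => lam)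
      (fun i : Bool => cond i B1 B2) (fun i => cond i κ1 κ2) ω := by
  obtain ⟨ω1, ω2, hsum, hm1, hm2, hb1, hb2, hi1, hi2, hz1, hz2⟩ := hω
  refine ⟨(hm1.add hm2).aestronglyMeasurable.congr hsum.symm, ?_, ?_⟩
  · filter_upwards [hsum, hb1, hb2, hz1, hz2] with x hs h1 h2 h3 h4
    rw [hs, Pi.add_apply]
    by_cases hx1 : x ∈ B1
    · have hx2 : x ∉ B2 := hd.notMem_of_mem_left hx1
      simp [hx1, hx2, h4 hx2, h1]
    · by_cases hx2 : x ∈ B2 <;> simp [hx1, hx2, h3 hx1, h2, h4]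
  · rintro (_ | _)
    · change ∫ x in B2, ω x ∂(volume.restrict D) = κ2
      rw [← hi2, ← setIntegral_eq_integral_of_ae_compl_eq_zero hz2]
      refine setIntegral_congr_ae hB2 ?_
      filter_upwards [hsum, hz1] with x hs h hx
      rw [hs, Pi.add_apply, h (hd.notMem_of_mem_right hx), zero_add]
    · change ∫ x in B1, ω x ∂(volume.restrict D) = κ1
      rw [← hi1, ← setIntegral_eq_integral_of_ae_compl_eq_zero hz1]
      refine setIntegral_congr_ae hB1 ?_
      filter_upwards [hsum, hz2] with x hs h hx
      rw [hs, Pi.add_apply, h (hd.notMem_of_mem_left hx), add_zero]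

lemma IsBoxConstrained.inK {D B1 B2 : Set Pt} {κ1 κ2 lam : ℝ} (hlam : 0 ≤ lam) {ω : Pt → ℝ}
    (hB1 : MeasurableSet B1) (hB2 : MeasurableSet B2) (hd : Disjoint B1 B2) (hm : Measurable ω)
    (hω : IsBoxConstrained (volume.restrict D) (B2.indicator fun _ => -lam)
      (B1.indicator fun _ => lam) (fun i : Bool => cond i B1 B2) (fun i => cond i κ1 κ2) ω) :
    InK D B1 B2 κ1 κ2 lam ω := by
  obtain ⟨-, hb, hi⟩ := hω
  refine ⟨B1.indicator ω, B2.indicator ω, ?_, hm.indicator hB1, hm.indicator hB2, ?_, ?_,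
    (integral_indicator hB1).trans (hi true), (integral_indicator hB2).trans (hi false),
    .of_forall fun x hx => indicator_of_notMem hx _,
    .of_forall fun x hx => indicator_of_notMem hx _⟩
  · filter_upwards [hb] with x h
    rw [Pi.add_apply]
    by_cases hx1 : x ∈ B1
    · simp [hx1, hd.notMem_of_mem_left hx1]
    · by_cases hx2 : x ∈ B2
      · simp [hx1, hx2]
      · simp only [hx1, hx2, not_false_eq_true, indicator_of_notMem] at h ⊢
        linarith
  · filter_upwards [hb] with x h
    by_cases hx1 : x ∈ B1
    · simpa [hx1, hd.notMem_of_mem_left hx1] using h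
    · simpa [hx1] using hlam
  · filter_upwards [hb] with x h
    by_cases hx2 : x ∈ B2
    · simpa [hx2, hd.notMem_of_mem_right hx2] using h
    · simpa [hx2] using hlam

/-- A step function that is constant on `B1` and on `B2` meets the constraints. -/
lemma exists_isBoxConstrained_of_le {α : Type*} [MeasurableSpace α] {μ : Measure α}
    {B1 B2 : Set α} (hB1 : MeasurableSet B1) (hB2 : MeasurableSet B2) (hd : Disjoint B1 B2)
    {κ1 κ2 lam m : ℝ} (hm : 0 < m) (hm1 : μ.real B1 = m) (hm2 : μ.real B2 = m)
    (hκ1 : 0 ≤ κ1) (hκ2 : κ2 ≤ 0) (h1 : κ1 ≤ lam * m) (h2 : -κ2 ≤ lam * m) :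
    ∃ f, IsBoxConstrained μ (B2.indicator fun _ => -lam) (B1.indicator fun _ => lam)
      (fun i : Bool => cond i B1 B2) (fun i => cond i κ1 κ2) f := by
  have hf1 : EqOn ((B1.indicator fun _ => κ1 / m) + B2.indicator fun _ => κ2 / m)
      (fun _ => κ1 / m) B1 := fun x hx => by simp [hx, hd.notMem_of_mem_left hx]
  have hf2 : EqOn ((B1.indicator fun _ => κ1 / m) + B2.indicator fun _ => κ2 / m)
      (fun _ => κ2 / m) B2 := fun x hx => by simp [hx, hd.notMem_of_mem_right hx]
  refine ⟨(B1.indicator fun _ => κ1 / m) + B2.indicator fun _ => κ2 / m,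
    ((measurable_const.indicator hB1).add (measurable_const.indicator hB2)).aestronglyMeasurable,
    .of_forall fun x => ?_, ?_⟩
  · by_cases hx1 : x ∈ B1
    · rw [hf1 hx1]
      simpa [hx1, hd.notMem_of_mem_left hx1] using
        And.intro (div_nonneg hκ1 hm.le) ((div_le_iff₀ hm).2 h1)
    · by_cases hx2 : x ∈ B2
      · rw [hf2 hx2]
        simpa [hx1, hx2] using
          And.intro ((le_div_iff₀ hm).2 (by linarith : -lam * m ≤ κ2))
            (div_nonpos_of_nonpos_of_nonneg hκ2 hm.le)
      · simp [hx1, hx2]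
  · rintro (_ | _)
    · refine (setIntegral_congr_fun hB2 hf2).trans ?_
      rw [setIntegral_const, hm2, smul_eq_mul, mul_div_cancel₀ _ hm.ne']
      rfl
    · refine (setIntegral_congr_fun hB1 hf1).trans ?_
      rw [setIntegral_const, hm1, smul_eq_mul, mul_div_cancel₀ _ hm.ne']
      rfl

lemma energy_eq_integral_prod {D : Set Pt} {G : Pt → Pt → ℝ}
    (hG : Integrable (fun p : Pt × Pt => G p.1 p.2)
      ((volume.restrict D).prod (volume.restrict D)))
    {ω : Pt → ℝ} {C : ℝ} (hω : AEStronglyMeasurable ω (volume.restrict D))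
    (hb : ∀ᵐ x ∂(volume.restrict D), |ω x| ≤ C) :
    energy D G ω = (1 / 2) *
      ∫ p, G p.1 p.2 * (ω p.1 * ω p.2) ∂((volume.restrict D).prod (volume.restrict D)) := by
  rw [energy, integral_prod _ (integrable_mul_tensor_self hω hb hG)]
  simp_rw [mul_assoc]

lemma volume_real_closedBall_pt (x : Pt) {δ : ℝ} (hδ : 0 ≤ δ) :
    volume.real (closedBall x δ) = π * δ ^ 2 := by
  rw [measureReal_def, EuclideanSpace.volume_closedBall_fin_two, ENNReal.toReal_mul,
    ENNReal.toReal_pow, ENNReal.toReal_ofReal hδ, ENNReal.toReal_ofReal pi_pos.le, mul_comm]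

theorem stmt0
    (D : Set Pt) (hDo : IsOpen D) (hDb : Bornology.IsBounded D)
    (xb1 xb2 : Pt) (hx : xb1 ≠ xb2) (δ : ℝ) (hδ : 0 < δ)
    (hB1D : closedBall xb1 δ ⊆ D) (hB2D : closedBall xb2 δ ⊆ D)
    (hBdisj : Disjoint (closedBall xb1 δ) (closedBall xb2 δ))
    (κ1 κ2 : ℝ) (hκ1 : 0 < κ1) (hκ2 : κ2 < 0)
    (G : Pt → Pt → ℝ)
    (hG : IntegrableOn (fun p : Pt × Pt => G p.1 p.2) (D ×ˢ D))
    (lam : ℝ) (hlam : 0 < lam)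
    (hlam' : max κ1 (-κ2) ≤ lam * (π * δ ^ 2)) :
    (∀ ω, InK D (closedBall xb1 δ) (closedBall xb2 δ) κ1 κ2 lam ω →
        energy D G ω ≤ (lam ^ 2 / 2) * ∫ x in D, ∫ y in D, |G x y|) ∧
    ∃ ωm, InK D (closedBall xb1 δ) (closedBall xb2 δ) κ1 κ2 lam ωm ∧
      ∀ ω, InK D (closedBall xb1 δ) (closedBall xb2 δ) κ1 κ2 lam ω →
        energy D G ω ≤ energy D G ωm := by
  have hB1 : MeasurableSet (closedBall xb1 δ) := measurableSet_closedBall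
  have hB2 : MeasurableSet (closedBall xb2 δ) := measurableSet_closedBall
  have : IsFiniteMeasure (volume.restrict D) :=
    isFiniteMeasure_restrict.2 hDb.measure_lt_top.ne
  have hG' : Integrable (fun p : Pt × Pt => G p.1 p.2)
      ((volume.restrict D).prod (volume.restrict D)) := by
    rwa [Measure.prod_restrict]
  have haC : ∀ x, -lam ≤ (closedBall xb2 δ).indicator (fun _ => -lam) x := fun x =>
    le_indicator_apply (fun _ => le_rfl) fun _ => by linarith
  have hbC : ∀ x, (closedBall xb1 δ).indicator (fun _ => lam) x ≤ lam := fun x =>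
    indicator_apply_le' (fun _ => le_rfl) fun _ => hlam.le
  have henergy : ∀ ω, InK D (closedBall xb1 δ) (closedBall xb2 δ) κ1 κ2 lam ω →
      energy D G ω = (1 / 2) *
        ∫ p, G p.1 p.2 * (ω p.1 * ω p.2) ∂((volume.restrict D).prod (volume.restrict D)) :=
    fun ω hω =>
      have h := hω.isBoxConstrained hB1 hB2 hBdisj
      energy_eq_integral_prod hG' h.1 (h.ae_abs_le haC hbC)
  constructor
  · intro ω hω
    have hb := (hω.isBoxConstrained hB1 hB2 hBdisj).ae_abs_le haC hbC
    have h := (le_abs_self _).trans (abs_integral_mul_tensor_self_le hb hG')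
    rw [integral_prod _ hG'.abs] at h
    rw [henergy ω hω]
    linarith
  · have hreal : ∀ x, closedBall x δ ⊆ D →
        (volume.restrict D).real (closedBall x δ) = π * δ ^ 2 := fun x hxD => by
      rw [measureReal_restrict_apply measurableSet_closedBall, inter_eq_left.2 hxD,
        volume_real_closedBall_pt x hδ.le]
    obtain ⟨ωm, hm, hωm, hmax⟩ := exists_isBoxConstrained_forall_integral_le
      ((integrable_const (-lam)).indicator hB2) ((integrable_const lam).indicator hB1)
      (Bool.forall_bool.2 ⟨hB2, hB1⟩) haC hbC hG'
      (exists_isBoxConstrained_of_le hB1 hB2 hBdisj (by positivity) (hreal xb1 hB1D)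
        (hreal xb2 hB2D) hκ1.le hκ2.le ((le_max_left _ _).trans hlam')
        ((le_max_right _ _).trans hlam'))
    have hωmK := hωm.inK hlam.le hB1 hB2 hBdisj hm
    refine ⟨ωm, hωmK, fun ω hω => ?_⟩
    rw [henergy ω hω, henergy ωm hωmK]
    exact mul_le_mul_of_nonneg_left (hmax ω (hω.isBoxConstrained hB1 hB2 hBdisj)) (by norm_num)
end
end

section
/- Assume G ∈ L¹(D × D). If (ω_n) is a sequence in L^∞(D) with ‖ω_n‖_{L^∞} ≤ λ for all n and ω_n → ω weak-star in L^∞(D), then the energies converge: ∫_D∫_D G(x,y) ω_n(x) ω_n(y) dx dy → ∫_D∫_D G(x,y) ω(x) ω(y) dx dy. -/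
open MeasureTheory Metric Set Filter Topology Real

noncomputable section

/-- A bounded function of the second variable can be integrated against an integrable kernel. -/
lemma integrable_integral_bdd_mul_kernel {α : Type*} [MeasurableSpace α] {μ : Measure α}
    [SFinite μ] {G : α → α → ℝ} (hG : Integrable (fun p : α × α => G p.1 p.2) (μ.prod μ))
    {lam : ℝ} {f : α → ℝ} (hf : Measurable f) (hbd : ∀ᵐ x ∂μ, |f x| ≤ lam) :
    Integrable (fun x => ∫ y, f y * G x y ∂μ) μ := by
  have h : Integrable (fun p : α × α => f p.2 * G p.1 p.2) (μ.prod μ) :=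
    hG.bdd_mul (c := lam) (hf.comp measurable_snd).aestronglyMeasurable
      (Measure.quasiMeasurePreserving_snd.ae hbd)
  exact h.integral_prod_left

/-- The quadratic energy of an integrable kernel is sequentially continuous along bounded
sequences that converge against every integrable function. -/
lemma tendsto_energy_of_integrable_kernel {α : Type*} [MeasurableSpace α] {μ : Measure α}
    [SFinite μ] {G : α → α → ℝ} (hG : Integrable (fun p : α × α => G p.1 p.2) (μ.prod μ))
    {lam : ℝ} {u : ℕ → α → ℝ} (hu : ∀ n, Measurable (u n))
    (hubd : ∀ n, ∀ᵐ x ∂μ, |u n x| ≤ lam)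
    {v : α → ℝ} (hv : Measurable v) (hvbd : ∀ᵐ x ∂μ, |v x| ≤ lam)
    (hconv : ∀ φ : α → ℝ, Integrable φ μ →
      Tendsto (fun n => ∫ x, u n x * φ x ∂μ) atTop (𝓝 (∫ x, v x * φ x ∂μ))) :
    Tendsto (fun n => ∫ x, ∫ y, G x y * u n x * u n y ∂μ ∂μ) atTop
      (𝓝 (∫ x, ∫ y, G x y * v x * v y ∂μ ∂μ)) := by
  have energy_eq (f : α → ℝ) : ∫ x, ∫ y, G x y * f x * f y ∂μ ∂μ
      = ∫ x, f x * ∫ y, f y * G x y ∂μ ∂μ := by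
    congr 1 with x
    rw [← integral_const_mul]
    congr 1 with y
    ring
  simp only [energy_eq]
  have hgn n := integrable_integral_bdd_mul_kernel hG (hu n) (hubd n)
  have hg := integrable_integral_bdd_mul_kernel hG hv hvbd
  have potential_bound {f : α → ℝ} (hf : ∀ᵐ x ∂μ, |f x| ≤ lam) :
      ∀ᵐ x ∂μ, ‖∫ y, f y * G x y ∂μ‖ ≤ lam * ∫ y, ‖G x y‖ ∂μ := by
    filter_upwards [hG.prod_right_ae] with x hx
    rw [← integral_const_mul]
    refine norm_integral_le_of_norm_le (hx.norm.const_mul lam) ?_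
    filter_upwards [hf] with y hy
    rw [norm_mul]
    exact mul_le_mul_of_nonneg_right hy (norm_nonneg _)
  have error_tendsto : Tendsto
      (fun n => ∫ x, u n x * ((∫ y, u n y * G x y ∂μ) - ∫ y, v y * G x y ∂μ) ∂μ)
      atTop (𝓝 (∫ _, (0 : ℝ) ∂μ)) := by
    refine tendsto_integral_of_dominated_convergence
      (fun x => lam * (2 * (lam * ∫ y, ‖G x y‖ ∂μ))) ?_ ?_ ?_ ?_
    · exact fun n => (hu n).aestronglyMeasurable.mul ((hgn n).sub hg).aestronglyMeasurable
    · exact ((hG.norm.integral_prod_left.const_mul lam).const_mul 2).const_mul lam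
    · intro n
      filter_upwards [hubd n, potential_bound (hubd n), potential_bound hvbd] with x h1 h2 h3
      rw [norm_mul]
      refine mul_le_mul h1 ((norm_sub_le _ _).trans (by linarith)) (norm_nonneg _)
        ((abs_nonneg _).trans h1)
    · filter_upwards [hG.prod_right_ae, ae_all_iff.2 hubd] with x hx hb
      refine squeeze_zero_norm
        (a := fun n => lam * ‖(∫ y, u n y * G x y ∂μ) - ∫ y, v y * G x y ∂μ‖) (fun n => ?_) ?_
      · rw [norm_mul]
        exact mul_le_mul_of_nonneg_right (hb n) (norm_nonneg _)
      · simpa using ((tendsto_sub_nhds_zero_iff.2 (hconv _ hx)).norm).const_mul lam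
  have key := error_tendsto.add (hconv _ hg)
  rw [integral_zero, zero_add] at key
  refine key.congr fun n => ?_
  rw [← integral_add]
  · congr 1 with x
    ring
  · exact ((hgn n).sub hg).bdd_mul (c := lam) (hu n).aestronglyMeasurable (hubd n)
  · exact hg.bdd_mul (c := lam) (hu n).aestronglyMeasurable (hubd n)

theorem stmt2
    (D : Set Pt) (hDo : IsOpen D) (hDb : Bornology.IsBounded D)
    (G : Pt → Pt → ℝ)
    (hG : IntegrableOn (fun p : Pt × Pt => G p.1 p.2) (D ×ˢ D))
    (lam : ℝ) (hlam : 0 < lam)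
    (ωn : ℕ → Pt → ℝ) (hmeas : ∀ n, Measurable (ωn n))
    (hbd : ∀ n, ∀ᵐ x ∂(volume.restrict D), |ωn n x| ≤ lam)
    (ω : Pt → ℝ) (hωmeas : Measurable ω)
    (hωbd : ∀ᵐ x ∂(volume.restrict D), |ω x| ≤ lam)
    (hconv : ∀ φ : Pt → ℝ, IntegrableOn φ D →
      Tendsto (fun n => ∫ x in D, ωn n x * φ x) atTop (𝓝 (∫ x in D, ω x * φ x))) :
    Tendsto (fun n => ∫ x in D, ∫ y in D, G x y * ωn n x * ωn n y) atTop
      (𝓝 (∫ x in D, ∫ y in D, G x y * ω x * ω y)) := by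
  rw [IntegrableOn, Measure.volume_eq_prod, ← Measure.prod_restrict] at hG
  exact tendsto_energy_of_integrable_kernel hG hmeas hbd hωmeas hωbd hconv
end
end

section
/- Assume G ∈ L¹(D × D) is symmetric (G(x,y) = G(y,x)). Let ω^λ ∈ K_λ be a maximizer of E over K_λ, and assume its stream function ψ^λ(x) = ∫_D G(x,y) ω^λ(y) dy is continuous on D, lies in C¹(D) ∩ W^{2,2}_loc(D), and satisfies −Δψ^λ = ω^λ almost everywhere in D. Then there exist real numbers μ₁^λ, μ₂^λ such that, for i = 1,2, ω_i^λ = sgn(κ_i)·λ·1_{Ω_i} almost everywhere, where Ω_i = {x ∈ B_i : sgn(κ_i) ψ^λ(x) > μ_i^λ}. -/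
open MeasureTheory Metric Set Filter Topology Real

noncomputable section

/-- The partial derivative `∂ᵢ f` of a function on the plane. -/
def pderiv2 (i : Fin 2) (f : Pt → ℝ) (x : Pt) : ℝ :=
  fderiv ℝ f x (EuclideanSpace.single i 1)

/-- The Laplacian of a function on the plane, via iterated partial derivatives. -/
def lapl (f : Pt → ℝ) (x : Pt) : ℝ :=
  ∑ i : Fin 2, pderiv2 i (pderiv2 i f) x

/-- At almost every point of a level set of a function, its Fréchet derivative vanishes. -/
theorem ae_fderiv_eq_zero_of_eqOn_const {E : Type*} [NormedAddCommGroup E] [NormedSpace ℝ E]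
    [FiniteDimensional ℝ E] [MeasurableSpace E] [BorelSpace E] (μ : Measure E)
    [μ.IsAddHaarMeasure] {f : E → ℝ} {s : Set E} (hs : MeasurableSet s) {c : ℝ}
    (hf : ∀ x ∈ s, f x = c) : ∀ᵐ x ∂μ, x ∈ s → fderiv ℝ f x = 0 := by
  rcases subsingleton_or_nontrivial E with hE | hE
  · exact ae_of_all _ fun x _ => Subsingleton.elim _ _
  obtain ⟨v, hv⟩ := exists_ne (0 : E)
  have hmeas : MeasurableSet (s ∩ {x | DifferentiableAt ℝ f x}) :=
    hs.inter (measurableSet_of_differentiableAt ℝ f)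
  have happ : ApproximatesLinearOn (fun x => f x • v) (0 : E →L[ℝ] E)
      (s ∩ {x | DifferentiableAt ℝ f x}) 0 := by
    intro x hx y hy
    simp [hf x hx.1, hf y hy.1]
  have key := happ.norm_fderiv_sub_le μ hmeas (fun x => (fderiv ℝ f x).smulRight v)
    fun x hx => (hx.2.hasFDerivAt.smul_const v).hasFDerivWithinAt
  rw [ae_restrict_iff' hmeas] at key
  filter_upwards [key] with x hx hxs
  by_cases hd : DifferentiableAt ℝ f x
  · simpa [hv] using hx ⟨hxs, hd⟩
  · exact fderiv_zero_of_not_differentiableAt hd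

/-- At almost every point of a level set of a function on the plane, its Laplacian vanishes. -/
theorem ae_lapl_eq_zero_of_eqOn_const {f : Pt → ℝ} {s : Set Pt} (hs : MeasurableSet s) {c : ℝ}
    (hf : ∀ x ∈ s, f x = c) : ∀ᵐ x, x ∈ s → lapl f x = 0 := by
  have hs' : MeasurableSet (s ∩ {x | fderiv ℝ f x = 0}) :=
    hs.inter (measurable_fderiv ℝ f (measurableSet_singleton 0))
  have hp (i : Fin 2) : ∀ᵐ x, x ∈ s ∩ {x | fderiv ℝ f x = 0} →
      fderiv ℝ (pderiv2 i f) x = 0 :=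
    ae_fderiv_eq_zero_of_eqOn_const volume hs' (c := 0) fun x hx => by
      have : fderiv ℝ f x = 0 := hx.2
      simp [pderiv2, this]
  filter_upwards [ae_fderiv_eq_zero_of_eqOn_const volume hs hf, ae_all_iff.2 hp] with x h1 h2 hxs
  have (i : Fin 2) : pderiv2 i (pderiv2 i f) x = 0 := by
    rw [pderiv2, h2 i ⟨hxs, h1 hxs⟩]
    rfl
  simp [lapl, this]

/-- **Bathtub principle**: if a density `0 ≤ w ≤ L` on `B` cannot be rearranged so as to increase
its integral against `f`, then it saturates the upper bound above some level of `f` and vanishes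
below that level. -/
theorem exists_level_of_forall_integral_mul_le_zero {α : Type*} [MeasurableSpace α]
    {ν : Measure α} [IsFiniteMeasure ν] {B : Set α} (hB : MeasurableSet B) {L : ℝ}
    {w f : α → ℝ} (hw : Measurable w) (hwL : ∀ᵐ x ∂ν, 0 ≤ w x ∧ w x ≤ L)
    (hw0 : ¬ ∀ᵐ x ∂ν, x ∈ B → w x = 0) (hf : Measurable f) {M : ℝ} (hfM : ∀ x, |f x| ≤ M)
    (hmax : ∀ h : α → ℝ, Measurable h → (∀ᵐ x ∂ν, 0 ≤ w x + h x ∧ w x + h x ≤ L) →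
      (∀ x ∉ B, h x = 0) → ∫ x, h x ∂ν = 0 → ∫ x, f x * h x ∂ν ≤ 0) :
    ∃ m : ℝ, ∀ᵐ x ∂ν, x ∈ B → (f x < m → w x = 0) ∧ (m < f x → w x = L) := by
  have hexch (s t : ℝ) (hst : s < t) : (∀ᵐ x ∂ν, x ∈ B → f x ≤ s → w x = 0) ∨
      ∀ᵐ x ∂ν, x ∈ B → t ≤ f x → w x = L := by
    set S : Set α := B ∩ {x | f x ≤ s} with hS
    set T : Set α := B ∩ {x | t ≤ f x} with hT
    have hSm : MeasurableSet S := hB.inter (hf measurableSet_Iic)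
    have hTm : MeasurableSet T := hB.inter (hf measurableSet_Ici)
    set u : α → ℝ := S.indicator w with hu
    set v : α → ℝ := T.indicator (fun x => L - w x) with hv
    have hum : Measurable u := hw.indicator hSm
    have hvm : Measurable v := (measurable_const.sub hw).indicator hTm
    have hub : ∀ᵐ x ∂ν, 0 ≤ u x ∧ u x ≤ w x := by
      filter_upwards [hwL] with x hx
      by_cases hxS : x ∈ S <;> simp [hu, hxS, hx.1]
    have hvb : ∀ᵐ x ∂ν, 0 ≤ v x ∧ v x ≤ L - w x := by
      filter_upwards [hwL] with x hx
      by_cases hxT : x ∈ T <;> simp [hv, hxT, hx.2]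
    have hui : Integrable u ν := by
      refine .of_bound hum.aestronglyMeasurable L ?_
      filter_upwards [hwL, hub] with x h1 h2
      rw [Real.norm_eq_abs, abs_of_nonneg h2.1]
      linarith
    have hvi : Integrable v ν := by
      refine .of_bound hvm.aestronglyMeasurable L ?_
      filter_upwards [hwL, hvb] with x h1 h2
      rw [Real.norm_eq_abs, abs_of_nonneg h2.1]
      linarith
    have hu0 : 0 ≤ᵐ[ν] u := hub.mono fun x hx => hx.1
    have hv0 : 0 ≤ᵐ[ν] v := hvb.mono fun x hx => hx.1
    set a := ∫ x, u x ∂ν with ha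
    set b := ∫ x, v x ∂ν with hb
    have ha0 : 0 ≤ a := integral_nonneg_of_ae hu0
    have hb0 : 0 ≤ b := integral_nonneg_of_ae hv0
    rcases ha0.eq_or_lt with ha' | ha'
    · left
      filter_upwards [(integral_eq_zero_iff_of_nonneg_ae hu0 hui).1 ha'.symm] with x hx hxB hxs
      have hxS : x ∈ S := ⟨hxB, hxs⟩
      simpa [hu, hxS] using hx
    rcases hb0.eq_or_lt with hb' | hb'
    · right
      filter_upwards [(integral_eq_zero_iff_of_nonneg_ae hv0 hvi).1 hb'.symm] with x hx hxB hxt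
      have hxT : x ∈ T := ⟨hxB, hxt⟩
      have : L - w x = 0 := by simpa [hv, hxT] using hx
      linarith
    exfalso
    set p := a / (a + b) with hp
    set q := b / (a + b) with hq
    have hp0 : 0 < p := by positivity
    have hq0 : 0 < q := by positivity
    have hpq : p + q = 1 := by rw [hp, hq]; field_simp
    have hbal : p * b = q * a := by rw [hp, hq]; ring
    have hh : ∫ x, (p * v x - q * u x) ∂ν = 0 := by
      rw [integral_sub (hvi.const_mul p) (hui.const_mul q), integral_const_mul,
        integral_const_mul]
      linarith
    have hle := hmax (fun x => p * v x - q * u x) ((hvm.const_mul p).sub (hum.const_mul q))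
      (by
        filter_upwards [hub, hvb, hwL] with x h1 h2 h3
        constructor <;> nlinarith)
      (by
        intro x hx
        have h1 : x ∉ S := fun h => hx h.1
        have h2 : x ∉ T := fun h => hx h.1
        simp [hu, hv, h1, h2])
      hh
    have hlow : ∫ x, (p * t * v x - q * s * u x) ∂ν ≤ ∫ x, f x * (p * v x - q * u x) ∂ν := by
      refine integral_mono_ae ((hvi.const_mul _).sub (hui.const_mul _))
        (((hvi.const_mul p).sub (hui.const_mul q)).bdd_mul hf.aestronglyMeasurable
          (ae_of_all _ hfM)) ?_
      filter_upwards [hu0, hv0] with x hux hvx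
      have h1 : t * v x ≤ f x * v x := by
        by_cases hxT : x ∈ T
        · exact mul_le_mul_of_nonneg_right hxT.2 hvx
        · simp [hv, hxT]
      have h2 : f x * u x ≤ s * u x := by
        by_cases hxS : x ∈ S
        · exact mul_le_mul_of_nonneg_right hxS.2 hux
        · simp [hu, hxS]
      nlinarith [mul_le_mul_of_nonneg_left h1 hp0.le, mul_le_mul_of_nonneg_left h2 hq0.le]
    rw [integral_sub (hvi.const_mul _) (hui.const_mul _), integral_const_mul,
      integral_const_mul, ← ha, ← hb] at hlow
    have : 0 < (t - s) * (q * a) := mul_pos (sub_pos.2 hst) (mul_pos hq0 ha')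
    have : p * t * b = t * (q * a) := by rw [← hbal]; ring
    linarith
  set U : Set ℝ := {s | ∀ᵐ x ∂ν, x ∈ B → f x ≤ s → w x = 0} with hU
  have hUne : U.Nonempty := by
    refine ⟨-M - 1, ae_of_all _ fun x _ hx => ?_⟩
    linarith [(abs_le.1 (hfM x)).1]
  have hUbdd : BddAbove U := by
    refine ⟨M, fun s hs => ?_⟩
    by_contra! hMs
    refine hw0 ?_
    filter_upwards [show ∀ᵐ x ∂ν, x ∈ B → f x ≤ s → w x = 0 from hs] with x hx hxB
    refine hx hxB ?_
    linarith [(abs_le.1 (hfM x)).2]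
  refine ⟨sSup U, ?_⟩
  have hbelow : ∀ᵐ x ∂ν, ∀ s : ℚ, (s : ℝ) < sSup U → x ∈ B → f x ≤ s → w x = 0 := by
    refine ae_all_iff.2 fun s => ?_
    by_cases hs : (s : ℝ) < sSup U
    · obtain ⟨r, hrU, hr⟩ := exists_lt_of_lt_csSup hUne hs
      filter_upwards [hrU] with x hx _ hxB hxs using hx hxB (hxs.trans hr.le)
    · exact ae_of_all _ fun x h => absurd h hs
  have habove : ∀ᵐ x ∂ν, ∀ t : ℚ, sSup U < (t : ℝ) → x ∈ B → t ≤ f x → w x = L := by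
    refine ae_all_iff.2 fun t => ?_
    by_cases ht : sSup U < (t : ℝ)
    · obtain ⟨r, hr, hrt⟩ := exists_between ht
      filter_upwards [(hexch r t hrt).resolve_left fun h => hr.not_ge (le_csSup hUbdd h)]
        with x hx _ using hx
    · exact ae_of_all _ fun x h => absurd h ht
  filter_upwards [hbelow, habove] with x h1 h2 hxB
  constructor
  · intro h
    obtain ⟨s, hs, hs'⟩ := exists_rat_btwn h
    exact h1 s hs' hxB hs.le
  · intro h
    obtain ⟨t, ht, ht'⟩ := exists_rat_btwn h
    exact h2 t ht hxB ht'.le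

/-- First variation of a symmetric quadratic energy: if the energy does not increase along the
segment from `u` in the direction `h`, then the potential of `u` integrates nonpositively
against `h`. -/
theorem integral_potential_mul_le_zero {D : Set Pt} {G : Pt → Pt → ℝ}
    (hG : IntegrableOn (fun p : Pt × Pt => G p.1 p.2) (D ×ˢ D))
    (hGsym : ∀ x y, G x y = G y x) {u h : Pt → ℝ} (hu : Measurable u) (hh : Measurable h)
    {C : ℝ} (huC : ∀ᵐ x ∂(volume.restrict D), |u x| ≤ C)
    (hhC : ∀ᵐ x ∂(volume.restrict D), |h x| ≤ C)
    (hmax : ∀ t ∈ Ioc (0 : ℝ) 1, energy D G (fun x => u x + t * h x) ≤ energy D G u) :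
    ∫ x in D, (∫ y in D, G x y * u y) * h x ≤ 0 := by
  set ν := volume.restrict D with hν
  have hGi : Integrable (fun p : Pt × Pt => G p.1 p.2) (ν.prod ν) := by
    rw [hν, Measure.prod_restrict, ← Measure.volume_eq_prod]
    exact hG
  have hint {a b : Pt → ℝ} (ha : Measurable a) (hb : Measurable b) (haC : ∀ᵐ x ∂ν, |a x| ≤ C)
      (hbC : ∀ᵐ x ∂ν, |b x| ≤ C) :
      Integrable (fun p : Pt × Pt => G p.1 p.2 * a p.1 * b p.2) (ν.prod ν) :=
    (hGi.mul_bdd (ha.comp measurable_fst).aestronglyMeasurable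
      (Measure.quasiMeasurePreserving_fst.ae haC)).mul_bdd
      (hb.comp measurable_snd).aestronglyMeasurable (Measure.quasiMeasurePreserving_snd.ae hbC)
  have iuu := hint hu hu huC huC
  have iuh := hint hu hh huC hhC
  have ihu := hint hh hu hhC huC
  have ihh := hint hh hh hhC hhC
  set P := ∫ p, G p.1 p.2 * h p.1 * u p.2 ∂(ν.prod ν) with hP
  set R := ∫ p, G p.1 p.2 * h p.1 * h p.2 ∂(ν.prod ν) with hR
  have hswap : ∫ p, G p.1 p.2 * u p.1 * h p.2 ∂(ν.prod ν) = P := by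
    rw [hP, ← integral_prod_swap]
    refine integral_congr_ae (ae_of_all _ fun p => ?_)
    simp only [Prod.fst_swap, Prod.snd_swap]
    rw [hGsym p.2 p.1]
    ring
  have hpot : ∫ x, (∫ y, G x y * u y ∂ν) * h x ∂ν = P := by
    rw [hP, integral_prod _ ihu]
    refine integral_congr_ae (ae_of_all _ fun x => ?_)
    simp only
    rw [← integral_mul_const]
    refine integral_congr_ae (ae_of_all _ fun y => ?_)
    simp only
    ring
  have hE (t : ℝ) : energy D G (fun x => u x + t * h x) =
      energy D G u + t * P + t ^ 2 / 2 * R := by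
    have expand : (fun p : Pt × Pt => G p.1 p.2 * (u p.1 + t * h p.1) * (u p.2 + t * h p.2)) =
        fun p => G p.1 p.2 * u p.1 * u p.2 + t * (G p.1 p.2 * u p.1 * h p.2) +
          t * (G p.1 p.2 * h p.1 * u p.2) + t ^ 2 * (G p.1 p.2 * h p.1 * h p.2) := by
      ext p
      ring
    have i1 := iuu.add (iuh.const_mul t)
    have i2 := i1.add (ihu.const_mul t)
    have i3 := i2.add (ihh.const_mul (t ^ 2))
    have itot : Integrable (fun p : Pt × Pt =>
        G p.1 p.2 * (u p.1 + t * h p.1) * (u p.2 + t * h p.2)) (ν.prod ν) := by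
      rw [expand]
      exact i3
    have hsplit : ∫ p, G p.1 p.2 * (u p.1 + t * h p.1) * (u p.2 + t * h p.2) ∂(ν.prod ν) =
        ∫ p, G p.1 p.2 * u p.1 * u p.2 ∂(ν.prod ν) + t * P + t * P + t ^ 2 * R := by
      rw [expand]
      refine (integral_add i2 (ihh.const_mul (t ^ 2))).trans ?_
      congr 1
      · refine (integral_add i1 (ihu.const_mul t)).trans ?_
        congr 1
        · refine (integral_add iuu (iuh.const_mul t)).trans ?_
          rw [integral_const_mul, hswap]
        · rw [integral_const_mul]
      · rw [integral_const_mul]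
    rw [integral_prod _ itot, integral_prod _ iuu] at hsplit
    simp only at hsplit
    simp only [energy, ← hν, hsplit]
    ring
  rw [hpot]
  by_contra! hPpos
  have hRa : 0 < |R| + P := by positivity
  have htpos : 0 < P / (|R| + P) := by positivity
  have ht1 : P / (|R| + P) ≤ 1 := (div_le_one hRa).2 (by linarith [abs_nonneg R])
  have h1 := hmax _ ⟨htpos, ht1⟩
  rw [hE] at h1
  set t := P / (|R| + P) with ht
  have htR : t * |R| ≤ P := by
    have : t * (|R| + P) = P := by rw [ht]; field_simp
    nlinarith
  have h2 : 0 < P + t / 2 * R := by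
    nlinarith [neg_abs_le R]
  nlinarith

/-- A bounded density that cannot be rearranged on the compact set `B` so as to increase its
integral against `f`, and that vanishes at almost every point of each level set of `f`, is a
constant multiple of the indicator of a superlevel set of `f`. -/
theorem exists_eq_indicator_superlevel {D B : Set Pt} (hD : Bornology.IsBounded D)
    (hB : IsCompact B) {L : ℝ} {w f : Pt → ℝ} (hw : Measurable w)
    (hwL : ∀ᵐ x ∂(volume.restrict D), 0 ≤ w x ∧ w x ≤ L)
    (hwB : ∀ᵐ x ∂(volume.restrict D), x ∉ B → w x = 0) (hwpos : ∫ x in D, w x ≠ 0)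
    (hf : ContinuousOn f B)
    (hlevel : ∀ c, ∀ᵐ x ∂(volume.restrict D), x ∈ B → f x = c → w x = 0)
    (hmax : ∀ h : Pt → ℝ, Measurable h →
      (∀ᵐ x ∂(volume.restrict D), 0 ≤ w x + h x ∧ w x + h x ≤ L) →
      (∀ x ∉ B, h x = 0) → ∫ x in D, h x = 0 → ∫ x in D, f x * h x ≤ 0) :
    ∃ m : ℝ, ∀ᵐ x ∂(volume.restrict D),
      w x = Set.indicator {y ∈ B | m < f y} (fun _ => L) x := by
  classical
  have : IsFiniteMeasure (volume.restrict D) :=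
    isFiniteMeasure_restrict.2 hD.measure_lt_top.ne
  obtain ⟨M, hM⟩ := hB.exists_bound_of_continuousOn hf
  have hfm : Measurable (B.indicator f) := by
    rw [← Set.piecewise_eq_indicator]
    exact hf.measurable_piecewise continuousOn_const hB.measurableSet
  have hfM (x : Pt) : |B.indicator f x| ≤ max M 0 := by
    by_cases hx : x ∈ B
    · simpa [hx] using Or.inl (hM x hx)
    · simp [hx]
  have hw0 : ¬ ∀ᵐ x ∂(volume.restrict D), x ∈ B → w x = 0 := fun h => by
    refine hwpos (integral_eq_zero_of_ae ?_)
    filter_upwards [h, hwB] with x h1 h2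
    by_cases hx : x ∈ B
    exacts [h1 hx, h2 hx]
  obtain ⟨m, hm⟩ := exists_level_of_forall_integral_mul_le_zero hB.measurableSet hw hwL hw0 hfm
    hfM fun h hh hhL hhB hh0 => by
      refine le_of_eq_of_le (integral_congr_ae (ae_of_all _ fun x => ?_)) (hmax h hh hhL hhB hh0)
      by_cases hx : x ∈ B
      · simp [hx]
      · simp [hhB x hx]
  refine ⟨m, ?_⟩
  filter_upwards [hm, hwB, hlevel m] with x h1 h2 h3
  by_cases hx : x ∈ B
  · rw [indicator_of_mem hx] at h1
    rcases lt_trichotomy (f x) m with h | h | h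
    · simp [(h1 hx).1 h, h.le]
    · simp [h3 hx h, h]
    · simp [(h1 hx).2 h, h, hx]
  · simp [h2 hx, hx]

theorem stmt3
    (D : Set Pt) (hDo : IsOpen D) (hDb : Bornology.IsBounded D)
    (xb1 xb2 : Pt) (hx : xb1 ≠ xb2) (δ : ℝ) (hδ : 0 < δ)
    (hB1D : closedBall xb1 δ ⊆ D) (hB2D : closedBall xb2 δ ⊆ D)
    (hBdisj : Disjoint (closedBall xb1 δ) (closedBall xb2 δ))
    (κ1 κ2 : ℝ) (hκ1 : 0 < κ1) (hκ2 : κ2 < 0)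
    (G : Pt → Pt → ℝ)
    (hG : IntegrableOn (fun p : Pt × Pt => G p.1 p.2) (D ×ˢ D))
    (hGsym : ∀ x y, G x y = G y x)
    (lam : ℝ) (hlam : 0 < lam)
    (ω1 ω2 : Pt → ℝ)
    (hadm : IsAdmissiblePair D (closedBall xb1 δ) (closedBall xb2 δ) κ1 κ2 lam ω1 ω2)
    (hmax : ∀ ω, InK D (closedBall xb1 δ) (closedBall xb2 δ) κ1 κ2 lam ω →
      energy D G ω ≤ energy D G (ω1 + ω2))
    (ψ : Pt → ℝ) (hψdef : ∀ x, ψ x = ∫ y in D, G x y * (ω1 y + ω2 y))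
    (hψcont : ContinuousOn ψ D)
    (hψC1 : ContDiffOn ℝ 1 ψ D)
    (hψW22 : ∀ K : Set Pt, K ⊆ D → IsCompact K →
      IntegrableOn (fun x => ‖fderiv ℝ (fderiv ℝ ψ) x‖ ^ 2) K)
    (hlap : ∀ᵐ x ∂(volume.restrict D), -lapl ψ x = ω1 x + ω2 x) :
    ∃ μ1 μ2 : ℝ,
      (∀ᵐ x ∂(volume.restrict D),
        ω1 x = Set.indicator {y ∈ closedBall xb1 δ | μ1 < ψ y} (fun _ => lam) x) ∧
      (∀ᵐ x ∂(volume.restrict D),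
        ω2 x = Set.indicator {y ∈ closedBall xb2 δ | μ2 < -ψ y} (fun _ => -lam) x) := by
  obtain ⟨hm1, hm2, hb1, hb2, hi1, hi2, hs1, hs2⟩ := hadm
  have : IsFiniteMeasure (volume.restrict D) :=
    isFiniteMeasure_restrict.2 hDb.measure_lt_top.ne
  have hvar (h1 h2 : Pt → ℝ) (hh1 : Measurable h1) (hh2 : Measurable h2)
      (hl1 : ∀ᵐ x ∂(volume.restrict D), 0 ≤ ω1 x + h1 x ∧ ω1 x + h1 x ≤ lam)
      (hl2 : ∀ᵐ x ∂(volume.restrict D), -lam ≤ ω2 x + h2 x ∧ ω2 x + h2 x ≤ 0)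
      (hz1 : ∀ x ∉ closedBall xb1 δ, h1 x = 0) (hz2 : ∀ x ∉ closedBall xb2 δ, h2 x = 0)
      (hj1 : ∫ x in D, h1 x = 0) (hj2 : ∫ x in D, h2 x = 0) :
      ∫ x in D, ψ x * (h1 x + h2 x) ≤ 0 := by
    have hint {a : Pt → ℝ} (ha : Measurable a)
        (hbd : ∀ᵐ x ∂(volume.restrict D), |a x| ≤ lam) : Integrable a (volume.restrict D) :=
      .of_bound ha.aestronglyMeasurable lam hbd
    have bω1 : ∀ᵐ x ∂(volume.restrict D), |ω1 x| ≤ lam := by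
      filter_upwards [hb1] with x h
      exact abs_le.2 ⟨by linarith, h.2⟩
    have bω2 : ∀ᵐ x ∂(volume.restrict D), |ω2 x| ≤ lam := by
      filter_upwards [hb2] with x h
      exact abs_le.2 ⟨h.1, by linarith⟩
    have bh1 : ∀ᵐ x ∂(volume.restrict D), |h1 x| ≤ lam := by
      filter_upwards [hb1, hl1] with x h h'
      exact abs_le.2 ⟨by linarith, by linarith⟩
    have bh2 : ∀ᵐ x ∂(volume.restrict D), |h2 x| ≤ lam := by
      filter_upwards [hb2, hl2] with x h h'
      exact abs_le.2 ⟨by linarith, by linarith⟩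
    have hle := integral_potential_mul_le_zero hG hGsym (u := ω1 + ω2)
      (h := fun x => h1 x + h2 x) (C := lam + lam) (hm1.add hm2) (hh1.add hh2)
      (by
        filter_upwards [bω1, bω2] with x h h'
        exact (abs_add_le _ _).trans (add_le_add h h'))
      (by
        filter_upwards [bh1, bh2] with x h h'
        exact (abs_add_le _ _).trans (add_le_add h h'))
      fun t ht => hmax _ ⟨fun x => ω1 x + t * h1 x, fun x => ω2 x + t * h2 x, ?_,
        hm1.add (hh1.const_mul t), hm2.add (hh2.const_mul t), ?_, ?_, ?_, ?_, ?_, ?_⟩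
    · simpa only [hψdef, Pi.add_apply] using hle
    · refine ae_of_all _ fun x => ?_
      simp only [Pi.add_apply]
      ring
    · filter_upwards [hb1, hl1] with x h h'
      constructor <;> nlinarith [ht.1, ht.2]
    · filter_upwards [hb2, hl2] with x h h'
      constructor <;> nlinarith [ht.1, ht.2]
    · rw [integral_add (hint hm1 bω1) ((hint hh1 bh1).const_mul t), integral_const_mul, hi1, hj1]
      ring
    · rw [integral_add (hint hm2 bω2) ((hint hh2 bh2).const_mul t), integral_const_mul, hi2, hj2]
      ring
    · filter_upwards [hs1] with x h hx
      rw [h hx, hz1 x hx]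
      ring
    · filter_upwards [hs2] with x h hx
      rw [h hx, hz2 x hx]
      ring
  have hflat {B : Set Pt} (hB : IsClosed B) (hBD : B ⊆ D) (c : ℝ) :
      ∀ᵐ x ∂(volume.restrict D), x ∈ B → ψ x = c → ω1 x + ω2 x = 0 := by
    have hS : MeasurableSet (B ∩ ψ ⁻¹' {c}) :=
      ((hψcont.mono hBD).preimage_isClosed_of_isClosed hB isClosed_singleton).measurableSet
    filter_upwards [hlap, ae_restrict_of_ae (ae_lapl_eq_zero_of_eqOn_const hS fun x hx => hx.2)]
      with x h1 h2 hxB hxc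
    rw [← h1, h2 ⟨hxB, hxc⟩, neg_zero]
  obtain ⟨μ1, hμ1⟩ := exists_eq_indicator_superlevel hDb (isCompact_closedBall xb1 δ) hm1 hb1 hs1
    (hi1.trans_ne hκ1.ne') (hψcont.mono hB1D)
    (fun c => by
      filter_upwards [hflat isClosed_closedBall hB1D c, hs2] with x h1 h2 hx hc
      simpa [h2 (disjoint_left.1 hBdisj hx)] using h1 hx hc)
    fun h hh hl hz hj => by
      simpa using hvar h 0 hh measurable_zero hl (by simpa using hb2) hz (by simp) hj (by simp)
  obtain ⟨μ2, hμ2⟩ := exists_eq_indicator_superlevel hDb (isCompact_closedBall xb2 δ)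
    (w := fun x => -ω2 x) (f := fun x => -ψ x) (L := lam) hm2.neg
    (hb2.mono fun x h => ⟨by linarith, by linarith⟩) (hs2.mono fun x h hx => by simp [h hx])
    (by rw [integral_neg, hi2]; linarith) (hψcont.mono hB2D).neg
    (fun c => by
      filter_upwards [hflat isClosed_closedBall hB2D (-c), hs1] with x h1 h2 hx hc
      simpa [h2 (disjoint_right.1 hBdisj hx)] using h1 hx (by linarith))
    fun h hh hl hz hj => by
      simpa using hvar 0 (-h) measurable_zero hh.neg (by simpa using hb1)
        (hl.mono fun x hx => by
          simp only [Pi.neg_apply]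
          constructor <;> linarith [hx.1, hx.2])
        (by simp) (fun x hx => by simp [hz x hx]) (by simp) (by simp [integral_neg, hj])
  refine ⟨μ1, μ2, hμ1, hμ2.mono fun x hx => ?_⟩
  rw [← neg_inj, hx]
  by_cases h : x ∈ {y ∈ closedBall xb2 δ | μ2 < -ψ y}
  · simp only [indicator_of_mem h, neg_neg]
  · simp only [indicator_of_notMem h, neg_zero]
end
end

section
/- Assume G(x,y) = −(1/(2π)) ln|x−y| − h(x,y) for x,y ∈ D, where h : D × D → ℝ is continuous. Fix δ₀ > 0 such that the closed balls of radius δ₀ about x̄₁ and x̄₂ are disjoint and contained in D. Then there exists a constant C > 0, independent of δ and λ, such that for every δ ∈ (0, δ₀], every λ > 0 with K_λ nonempty, every ω ∈ K_λ (with K_λ defined using the balls of radius δ), and every x on the circle ∂B_δ(x̄₁), the stream function ψ(x) = ∫_D G(x,y) ω(y) dy satisfies ψ(x) ≥ −(κ₁/(2π)) ln δ − C. -/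
open MeasureTheory Metric Set Filter Topology Real

noncomputable section

/-- The logarithm of the distance to a point is integrable on every disc centred there. -/
theorem integrableOn_log_dist_closedBall (x : Pt) (R : ℝ) :
    IntegrableOn (fun y => Real.log (dist x y)) (closedBall x R) := by
  have hnorm : Integrable
      (fun z : Pt => (Set.Iic R).indicator Real.log ‖z‖) := by
    rw [integrable_fun_norm_addHaar]
    have hdim : Module.finrank ℝ Pt = 2 := by simp
    have hcont : IntegrableOn (fun r : ℝ => r * Real.log r) (Set.Icc 0 R) :=
      Real.continuous_mul_log.continuousOn.integrableOn_compact isCompact_Icc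
    have hind := (hcont.integrable_indicator measurableSet_Icc).integrableOn (s := Set.Ioi 0)
    refine hind.congr_fun (fun r hr => ?_) measurableSet_Ioi
    rw [hdim]
    have hr0 : (0 : ℝ) ≤ r := le_of_lt hr
    by_cases hR : r ≤ R <;> simp [Set.indicator, hR, hr0]
  have hshift := hnorm.comp_sub_right x
  rw [← integrable_indicator_iff measurableSet_closedBall]
  refine hshift.congr (Filter.Eventually.of_forall fun y => ?_)
  simp only [Set.indicator, Set.mem_Iic, mem_closedBall, dist_eq_norm]
  rw [norm_sub_rev x y]

theorem stmt5
    (D : Set Pt) (hDo : IsOpen D) (hDb : Bornology.IsBounded D)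
    (xb1 xb2 : Pt) (hx : xb1 ≠ xb2)
    (κ1 κ2 : ℝ) (hκ1 : 0 < κ1) (hκ2 : κ2 < 0)
    (h : Pt → Pt → ℝ)
    (hh : ContinuousOn (fun p : Pt × Pt => h p.1 p.2) (D ×ˢ D))
    (G : Pt → Pt → ℝ)
    (hGdef : ∀ x ∈ D, ∀ y ∈ D, G x y = -(1 / (2 * π)) * Real.log (dist x y) - h x y)
    (δ0 : ℝ) (hδ0 : 0 < δ0)
    (hB1D : closedBall xb1 δ0 ⊆ D) (hB2D : closedBall xb2 δ0 ⊆ D)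
    (hBdisj : Disjoint (closedBall xb1 δ0) (closedBall xb2 δ0)) :
    ∃ C > 0, ∀ δ ∈ Set.Ioc (0 : ℝ) δ0, ∀ lam > 0, ∀ ω1 ω2 : Pt → ℝ,
      IsAdmissiblePair D (closedBall xb1 δ) (closedBall xb2 δ) κ1 κ2 lam ω1 ω2 →
      ∀ x ∈ sphere xb1 δ,
        -(κ1 / (2 * π)) * Real.log δ - C ≤ ∫ y in D, G x y * (ω1 y + ω2 y) := by
  set B1 := closedBall xb1 δ0 with hB1
  set B2 := closedBall xb2 δ0 with hB2
  have hK1 : IsCompact B1 := isCompact_closedBall _ _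
  have hK2 : IsCompact B2 := isCompact_closedBall _ _
  have hUD : B1 ∪ B2 ⊆ D := Set.union_subset hB1D hB2D
  obtain ⟨M, hM⟩ := (hK1.prod (hK1.union hK2)).exists_bound_of_continuousOn
    (hh.mono (Set.prod_mono hB1D hUD))
  have hlogc : ContinuousOn (fun p : Pt × Pt => Real.log (dist p.1 p.2)) (B1 ×ˢ B2) := by
    refine ContinuousOn.log (by fun_prop) ?_
    rintro ⟨a, b⟩ ⟨ha, hb⟩
    exact dist_ne_zero.2 (hBdisj.ne_of_mem ha hb)
  obtain ⟨L, hL⟩ := (hK1.prod hK2).exists_bound_of_continuousOn hlogc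
  have hπ : 0 < 1 / (2 * π) := by positivity
  refine ⟨κ1 * (1 / (2 * π) * Real.log 2 + |M|) + (-κ2) * (1 / (2 * π) * |L| + |M|) + 1, ?_, ?_⟩
  · have h2 : 0 < Real.log 2 := Real.log_pos one_lt_two
    have hκ2' : 0 < -κ2 := by linarith
    positivity
  rintro δ ⟨hδ, hδδ⟩ lam hlam ω1 ω2 ⟨hm1, hm2, hb1, hb2, hi1, hi2, hs1, hs2⟩ x hxs
  have hxB : x ∈ B1 := closedBall_subset_closedBall hδδ (sphere_subset_closedBall hxs)
  have hDm : MeasurableSet D := hDo.measurableSet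
  have : IsFiniteMeasure (volume.restrict D) := ⟨by
    rw [Measure.restrict_apply_univ]; exact hDb.measure_lt_top⟩
  have hint1 : Integrable ω1 (volume.restrict D) := by
    refine Integrable.of_bound hm1.aestronglyMeasurable lam ?_
    filter_upwards [hb1] with y hy
    rw [Real.norm_eq_abs, abs_le]; constructor <;> linarith
  have hint2 : Integrable ω2 (volume.restrict D) := by
    refine Integrable.of_bound hm2.aestronglyMeasurable lam ?_
    filter_upwards [hb2] with y hy
    rw [Real.norm_eq_abs, abs_le]; constructor <;> linarith
  have hKm : MeasurableSet (B1 ∪ B2) := (hK1.union hK2).measurableSet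
  have hlogint : IntegrableOn (fun y => Real.log (dist x y)) (B1 ∪ B2) := by
    obtain ⟨R, hR⟩ := (hK1.union hK2).isBounded.subset_closedBall x
    exact (integrableOn_log_dist_closedBall x R).mono_set hR
  have hhint : IntegrableOn (fun y => h x y) (B1 ∪ B2) := by
    refine ContinuousOn.integrableOn_compact (hK1.union hK2) ?_
    exact hh.comp (f := fun y => (x, y)) (by fun_prop) (fun y hy => ⟨hB1D hxB, hUD hy⟩)
  have hGint : Integrable ((B1 ∪ B2).indicator
      (fun y => -(1 / (2 * π)) * Real.log (dist x y) - h x y)) (volume.restrict D) :=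
    (IntegrableOn.integrable_indicator ((hlogint.const_mul _).sub hhint) hKm).mono_measure
      Measure.restrict_le_self
  have hprod := hGint.mul_bdd (c := 2 * lam) (g := fun y => ω1 y + ω2 y)
    (hm1.add hm2).aestronglyMeasurable (by
      filter_upwards [hb1, hb2] with y hy1 hy2
      rw [Real.norm_eq_abs, abs_le]; constructor <;> linarith)
  have hD : ∀ᵐ y ∂(volume.restrict D), y ∈ D := ae_restrict_mem hDm
  have hne : ∀ᵐ y ∂(volume.restrict D), y ≠ x := by
    refine ae_restrict_of_ae ?_
    exact compl_mem_ae_iff.2 (measure_singleton x)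
  have hLHS : Integrable (fun y => G x y * (ω1 y + ω2 y)) (volume.restrict D) := by
    refine hprod.congr ?_
    filter_upwards [hs1, hs2, hD] with y h1 h2 hyD
    by_cases hy : y ∈ B1 ∪ B2
    · simp only [Set.indicator_of_mem hy]
      rw [hGdef x (hB1D hxB) y hyD]
    · have e1 : ω1 y = 0 := h1 fun hc => hy (Or.inl (closedBall_subset_closedBall hδδ hc))
      have e2 : ω2 y = 0 := h2 fun hc => hy (Or.inr (closedBall_subset_closedBall hδδ hc))
      simp [e1, e2]
  set A := -(1 / (2 * π)) * Real.log (2 * δ) - |M| with hA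
  set A2 := 1 / (2 * π) * |L| + |M| with hA2
  have hmono : ∫ y in D, (A * ω1 y + A2 * ω2 y) ≤ ∫ y in D, G x y * (ω1 y + ω2 y) := by
    refine integral_mono_ae ((hint1.const_mul A).add (hint2.const_mul A2)) hLHS ?_
    filter_upwards [hs1, hs2, hb1, hb2, hD, hne] with y h1 h2 hp1 hp2 hyD hyx
    have hG := hGdef x (hB1D hxB) y hyD
    have hle1 : A * ω1 y ≤ G x y * ω1 y := by
      by_cases hy : y ∈ closedBall xb1 δ
      · refine mul_le_mul_of_nonneg_right ?_ hp1.1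
        have hMy := hM (x, y) ⟨hxB, Or.inl (closedBall_subset_closedBall hδδ hy)⟩
        rw [Real.norm_eq_abs] at hMy
        have hMy' := (le_abs_self _).trans (hMy.trans (le_abs_self M))
        have hdist : dist x y ≤ 2 * δ := by
          have := dist_triangle_right x y xb1
          rw [mem_sphere] at hxs
          rw [mem_closedBall] at hy
          linarith
        have hlog := Real.log_le_log (dist_pos.2 hyx.symm) hdist
        have := mul_le_mul_of_nonneg_left hlog hπ.le
        rw [hG, hA]
        simp only at hMy'
        linarith
      · simp [h1 hy]
    have hle2 : A2 * ω2 y ≤ G x y * ω2 y := by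
      by_cases hy : y ∈ closedBall xb2 δ
      · refine mul_le_mul_of_nonpos_right ?_ hp2.2
        have hyB := closedBall_subset_closedBall hδδ hy
        have hMy := hM (x, y) ⟨hxB, Or.inr hyB⟩
        have hLy := hL (x, y) ⟨hxB, hyB⟩
        rw [Real.norm_eq_abs] at hMy hLy
        have hMy' := (neg_le_abs _).trans (hMy.trans (le_abs_self M))
        have hLy' := (neg_le_abs _).trans (hLy.trans (le_abs_self L))
        have := mul_le_mul_of_nonneg_left hLy' hπ.le
        rw [hG, hA2]
        simp only at hMy' this
        linarith
      · simp [h2 hy]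
    linarith
  rw [integral_add (hint1.const_mul A) (hint2.const_mul A2), integral_const_mul,
    integral_const_mul, hi1, hi2] at hmono
  refine le_trans ?_ hmono
  rw [hA, Real.log_mul two_ne_zero hδ.ne']
  have : κ1 / (2 * π) = κ1 * (1 / (2 * π)) := by ring
  rw [this]
  linarith
end
end

section
/- Assume G(x,y) = −(1/(2π)) ln|x−y| − h(x,y) for x,y ∈ D, where h : D × D → ℝ is continuous. For λ > 0 set ε_i = √(|κ_i|/(λπ)), so that λ·|B_{ε_i}| = |κ_i|. Then there exist λ₀ > 0 and a constant C > 0 independent of λ such that for every λ ≥ λ₀ (in particular large enough that ε_i ≤ δ for i = 1,2), sup_{ω ∈ K_λ} E(ω) ≥ −(1/(4π))·(κ₁² ln ε₁ + κ₂² ln ε₂) − C. -/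
open MeasureTheory Metric Set Filter Topology Real

noncomputable section

lemma integrableOn_log_norm_closedBall (R : ℝ) :
    IntegrableOn (fun z : Pt => log ‖z‖) (closedBall 0 R) := by
  rw [← integrable_indicator_iff isClosed_closedBall.measurableSet]
  have hrad : (closedBall (0 : Pt) R).indicator (fun z : Pt => log ‖z‖)
      = fun z : Pt => (Iic R).indicator log ‖z‖ := by
    ext z
    simp [indicator]
  rw [hrad, integrable_fun_norm_addHaar (volume : Measure Pt)]
  have hsmul : (fun y : ℝ => y ^ (Module.finrank ℝ Pt - 1) • (Iic R).indicator log y)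
      = (Iic R).indicator fun y => y * log y := by
    ext y
    by_cases hy : y ∈ Iic R <;> simp [hy]
  rw [hsmul, IntegrableOn, integrable_indicator_iff measurableSet_Iic, IntegrableOn,
    Measure.restrict_restrict measurableSet_Iic]
  refine (Real.continuous_mul_log.continuousOn.integrableOn_compact
    (isCompact_Icc (a := (0 : ℝ)) (b := R))).mono_set ?_
  rintro y ⟨hyR, hy0⟩
  exact ⟨le_of_lt hy0, hyR⟩

lemma integrableOn_log_dist {S : Set Pt} (hS : Bornology.IsBounded S) (hSm : MeasurableSet S) :
    IntegrableOn (fun p : Pt × Pt => log (dist p.1 p.2)) (S ×ˢ S) := by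
  have hone : Integrable (S.indicator fun _ => (1 : ℝ)) (volume : Measure Pt) :=
    (integrable_indicator_iff hSm).2 (integrableOn_const hS.measure_lt_top.ne)
  have hlog : Integrable ((closedBall (0 : Pt) (diam S)).indicator fun z => log ‖z‖) :=
    (integrable_indicator_iff isClosed_closedBall.measurableSet).2
      (integrableOn_log_norm_closedBall _)
  refine (hone.convolution_integrand (ContinuousLinearMap.mul ℝ ℝ) hlog).integrableOn.congr_fun
    ?_ (hSm.prod hSm)
  rintro ⟨x, y⟩ ⟨hx, hy⟩
  have hmem : x - y ∈ closedBall (0 : Pt) (diam S) := by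
    simpa [dist_eq_norm] using dist_le_diam_of_mem hS hx hy
  have hy' : y ∈ S := hy
  simp only [ContinuousLinearMap.mul_apply', indicator_of_mem hy', indicator_of_mem hmem, one_mul,
    dist_eq_norm]

lemma ae_prod_fst_ne_snd {α : Type*} [MeasurableSpace α] [MeasurableEq α] (μ : Measure α)
    [SFinite μ] [NullSingletonClass μ] : ∀ᵐ p : α × α ∂μ.prod μ, p.1 ≠ p.2 := by
  have hm : MeasurableSet {p : α × α | p.1 ≠ p.2} := measurableSet_diagonal.compl
  refine (Measure.ae_prod_iff_ae_ae hm).2 (Eventually.of_forall fun x => ?_)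
  simp [ae_iff]

/-- The vorticity patch of strength `s` on the closed disc of radius `r` about `c`. -/
def patch (c : Pt) (r s : ℝ) : Pt → ℝ := (closedBall c r).indicator fun _ => s

lemma measurable_patch (c : Pt) (r s : ℝ) : Measurable (patch c r s) :=
  measurable_const.indicator isClosed_closedBall.measurableSet

lemma patch_nonneg (c : Pt) (r : ℝ) {s : ℝ} (hs : 0 ≤ s) (x : Pt) : 0 ≤ patch c r s x :=
  indicator_nonneg (fun _ _ => hs) x

lemma patch_le (c : Pt) (r : ℝ) {s : ℝ} (hs : 0 ≤ s) (x : Pt) : patch c r s x ≤ s :=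
  indicator_le_self' (fun _ _ => hs) x

lemma patch_eq_zero {c x : Pt} {r s : ℝ} (hx : x ∉ closedBall c r) : patch c r s x = 0 :=
  indicator_of_notMem hx _

lemma integrable_patch (c : Pt) (r s : ℝ) (μ : Measure Pt) [IsLocallyFiniteMeasure μ] :
    Integrable (patch c r s) μ :=
  (integrable_indicator_iff isClosed_closedBall.measurableSet).2
    (integrableOn_const (isCompact_closedBall c r).measure_lt_top.ne)

lemma setIntegral_patch {D : Set Pt} {c : Pt} {κ s : ℝ} (hκ : 0 ≤ κ) (hs : 0 < s)
    (hD : closedBall c (√(κ / (s * π))) ⊆ D) :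
    ∫ x in D, patch c (√(κ / (s * π))) s x = κ := by
  rw [patch, setIntegral_indicator isClosed_closedBall.measurableSet, inter_eq_right.2 hD,
    setIntegral_const, measureReal_def, EuclideanSpace.volume_closedBall_fin_two,
    ENNReal.toReal_mul, ENNReal.toReal_pow, ENNReal.toReal_ofReal (sqrt_nonneg _),
    ENNReal.toReal_ofReal pi_pos.le, sq_sqrt (by positivity), smul_eq_mul]
  field_simp

lemma sqrt_div_mul_pi_le {κ s δ : ℝ} (hδ : 0 < δ) (hs : 0 < s) (hle : κ / (π * δ ^ 2) ≤ s) :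
    √(κ / (s * π)) ≤ δ := by
  rw [sqrt_le_left hδ.le, div_le_iff₀ (by positivity)]
  rw [div_le_iff₀ (by positivity)] at hle
  linarith

lemma log_dist_le_of_mem_closedBall {c x y : Pt} {r : ℝ} (hr : 0 < r) (hx : x ∈ closedBall c r)
    (hy : y ∈ closedBall c r) (hne : x ≠ y) : log (dist x y) ≤ log 2 + log r := by
  rw [← log_mul two_ne_zero hr.ne']
  refine log_le_log (dist_pos.2 hne) ?_
  have := dist_triangle_right x y c
  rw [mem_closedBall] at hx hy
  linarith

lemma mul_patch_mul_patch_le {c c' x y : Pt} {r r' s : ℝ} {a b : ℝ} (hs : 0 ≤ s)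
    (hab : x ∈ closedBall c r → y ∈ closedBall c' r' → a ≤ b) :
    a * (patch c r s x * patch c' r' s y) ≤ b * (patch c r s x * patch c' r' s y) := by
  by_cases hx : x ∈ closedBall c r
  · by_cases hy : y ∈ closedBall c' r'
    · exact mul_le_mul_of_nonneg_right (hab hx hy)
        (mul_nonneg (patch_nonneg _ _ hs _) (patch_nonneg _ _ hs _))
    · simp [patch_eq_zero hy]
  · simp [patch_eq_zero hx]

/-- Lower bound for the energy of a pair of patches of opposite signs, from one-sided bounds on the
kernel on each product of the two discs. -/
lemma le_energy_patch_sub_patch {D : Set Pt} {G : Pt → Pt → ℝ} {c₁ c₂ : Pt}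
    {r₁ r₂ s a₁ a₂ M κ₁ κ₂ : ℝ} (hs : 0 ≤ s)
    (hG : IntegrableOn (fun p : Pt × Pt => G p.1 p.2)
      ((closedBall c₁ r₁ ∪ closedBall c₂ r₂) ×ˢ (closedBall c₁ r₁ ∪ closedBall c₂ r₂)))
    (h₁ : ∫ x in D, patch c₁ r₁ s x = κ₁) (h₂ : ∫ x in D, patch c₂ r₂ s x = κ₂)
    (hG₁ : ∀ x ∈ closedBall c₁ r₁, ∀ y ∈ closedBall c₁ r₁, x ≠ y → a₁ ≤ G x y)
    (hG₂ : ∀ x ∈ closedBall c₂ r₂, ∀ y ∈ closedBall c₂ r₂, x ≠ y → a₂ ≤ G x y)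
    (hG₁₂ : ∀ x ∈ closedBall c₁ r₁, ∀ y ∈ closedBall c₂ r₂, G x y ≤ M)
    (hG₂₁ : ∀ x ∈ closedBall c₂ r₂, ∀ y ∈ closedBall c₁ r₁, G x y ≤ M) :
    (1 / 2) * (a₁ * κ₁ ^ 2 + a₂ * κ₂ ^ 2 - 2 * M * (κ₁ * κ₂))
      ≤ energy D G (patch c₁ r₁ s - patch c₂ r₂ s) := by
  set f := patch c₁ r₁ s with hf
  set g := patch c₂ r₂ s with hg
  set S := closedBall c₁ r₁ ∪ closedBall c₂ r₂ with hS
  have hfi : Integrable f (volume.restrict D) := integrable_patch c₁ r₁ s _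
  have hgi : Integrable g (volume.restrict D) := integrable_patch c₂ r₂ s _
  have hzero : ∀ x ∉ S, (f - g) x = 0 := by
    intro x hx
    simp only [hS, mem_union, not_or] at hx
    simp [hf, hg, patch_eq_zero hx.1, patch_eq_zero hx.2]
  have hbound : ∀ x, ‖(f - g) x‖ ≤ s := by
    intro x
    have hf0 := patch_nonneg c₁ r₁ hs x
    have hg0 := patch_nonneg c₂ r₂ hs x
    have hfs := patch_le c₁ r₁ hs x
    have hgs := patch_le c₂ r₂ hs x
    rw [Pi.sub_apply, norm_eq_abs, abs_le]
    constructor <;> linarith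
  have hmeas : Measurable (f - g) := (measurable_patch _ _ _).sub (measurable_patch _ _ _)
  have hint : Integrable (fun p : Pt × Pt => G p.1 p.2 * ((f - g) p.1 * (f - g) p.2)) := by
    rw [← integrableOn_iff_integrable_of_support_subset (s := S ×ˢ S)]
    · refine hG.mul_bdd (c := s * s) ?_ (Eventually.of_forall fun p => ?_)
      · exact ((hmeas.comp measurable_fst).mul (hmeas.comp measurable_snd)).aestronglyMeasurable
      · rw [norm_mul]
        exact mul_le_mul (hbound _) (hbound _) (norm_nonneg _) hs
    · rintro ⟨x, y⟩ hp
      by_contra hxy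
      rw [mem_prod, not_and_or] at hxy
      rcases hxy with hx | hy
      · exact hp (by simp only [hzero x hx, zero_mul, mul_zero])
      · exact hp (by simp only [hzero y hy, mul_zero])
  have hintD : Integrable (fun p : Pt × Pt => G p.1 p.2 * ((f - g) p.1 * (f - g) p.2))
      ((volume.restrict D).prod (volume.restrict D)) := by
    rw [Measure.prod_restrict]
    exact hint.integrableOn
  have henergy : energy D G (f - g) = (1 / 2) * ∫ p : Pt × Pt,
      G p.1 p.2 * ((f - g) p.1 * (f - g) p.2)
        ∂((volume.restrict D).prod (volume.restrict D)) := by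
    rw [energy, integral_prod _ hintD]
    simp only [mul_assoc]
  have hff := (hfi.mul_prod hfi).const_mul a₁
  have hgg := (hgi.mul_prod hgi).const_mul a₂
  have hfg := (hfi.mul_prod hgi).const_mul M
  have hgf := (hgi.mul_prod hfi).const_mul M
  have hsum : Integrable (fun p : Pt × Pt => a₁ * (f p.1 * f p.2) + a₂ * (g p.1 * g p.2))
      ((volume.restrict D).prod (volume.restrict D)) := hff.add hgg
  have hdiff : Integrable (fun p : Pt × Pt => a₁ * (f p.1 * f p.2) + a₂ * (g p.1 * g p.2)
      - M * (f p.1 * g p.2)) ((volume.restrict D).prod (volume.restrict D)) := hsum.sub hfg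
  have hlower : ∫ p : Pt × Pt, (a₁ * (f p.1 * f p.2) + a₂ * (g p.1 * g p.2)
        - M * (f p.1 * g p.2) - M * (g p.1 * f p.2))
        ∂((volume.restrict D).prod (volume.restrict D))
      = a₁ * κ₁ ^ 2 + a₂ * κ₂ ^ 2 - 2 * M * (κ₁ * κ₂) := by
    rw [integral_sub hdiff hgf, integral_sub hsum hfg, integral_add hff hgg]
    simp only [integral_const_mul, integral_prod_mul, h₁, h₂]
    ring
  rw [henergy, ← hlower]
  refine mul_le_mul_of_nonneg_left ?_ (by norm_num)
  refine integral_mono_ae (hdiff.sub hgf) hintD ?_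
  filter_upwards [ae_prod_fst_ne_snd (volume.restrict D)] with ⟨x, y⟩ hne
  have e₁ := mul_patch_mul_patch_le hs fun hx hy => hG₁ x hx y hy hne
  have e₂ := mul_patch_mul_patch_le hs fun hx hy => hG₂ x hx y hy hne
  have e₁₂ := mul_patch_mul_patch_le hs fun hx hy => hG₁₂ x hx y hy
  have e₂₁ := mul_patch_mul_patch_le hs fun hx hy => hG₂₁ x hx y hy
  simp only [Pi.sub_apply]
  linarith

theorem stmt6
    (D : Set Pt) (hDo : IsOpen D) (hDb : Bornology.IsBounded D)
    (xb1 xb2 : Pt) (hx : xb1 ≠ xb2) (δ : ℝ) (hδ : 0 < δ)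
    (hB1D : closedBall xb1 δ ⊆ D) (hB2D : closedBall xb2 δ ⊆ D)
    (hBdisj : Disjoint (closedBall xb1 δ) (closedBall xb2 δ))
    (κ1 κ2 : ℝ) (hκ1 : 0 < κ1) (hκ2 : κ2 < 0)
    (h : Pt → Pt → ℝ)
    (hh : ContinuousOn (fun p : Pt × Pt => h p.1 p.2) (D ×ˢ D))
    (G : Pt → Pt → ℝ)
    (hGdef : ∀ x ∈ D, ∀ y ∈ D, G x y = -(1 / (2 * π)) * Real.log (dist x y) - h x y) :
    ∃ lam0 > 0, ∃ C > 0, ∀ lam : ℝ, lam0 ≤ lam →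
      (Real.sqrt (κ1 / (lam * π)) ≤ δ ∧ Real.sqrt (-κ2 / (lam * π)) ≤ δ) ∧
      ∃ ω, InK D (closedBall xb1 δ) (closedBall xb2 δ) κ1 κ2 lam ω ∧
        -(1 / (4 * π)) * (κ1 ^ 2 * Real.log (Real.sqrt (κ1 / (lam * π)))
            + κ2 ^ 2 * Real.log (Real.sqrt (-κ2 / (lam * π)))) - C ≤ energy D G ω := by
  set B₁ := closedBall xb1 δ with hB₁
  set B₂ := closedBall xb2 δ with hB₂
  have hSc : IsCompact (B₁ ∪ B₂) := (isCompact_closedBall _ _).union (isCompact_closedBall _ _)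
  have hSD : B₁ ∪ B₂ ⊆ D := union_subset hB1D hB2D
  have hhS := hh.mono (prod_mono hSD hSD)
  obtain ⟨K, hK⟩ := (hSc.prod hSc).exists_bound_of_continuousOn hhS
  have hK' : ∀ x ∈ B₁ ∪ B₂, ∀ y ∈ B₁ ∪ B₂, |h x y| ≤ K := fun x hx y hy => hK (x, y) ⟨hx, hy⟩
  obtain ⟨N, hN⟩ := ((isCompact_closedBall xb1 δ).prod
      (isCompact_closedBall xb2 δ)).exists_bound_of_continuousOn
    (f := fun p : Pt × Pt => log (dist p.1 p.2))
    (ContinuousOn.log continuous_dist.continuousOn fun p hp =>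
      dist_ne_zero.2 (hBdisj.ne_of_mem hp.1 hp.2))
  have hN' : ∀ x ∈ B₁, ∀ y ∈ B₂, |log (dist x y)| ≤ N := fun x hx y hy => hN (x, y) ⟨hx, hy⟩
  have hGS : IntegrableOn (fun p : Pt × Pt => G p.1 p.2) ((B₁ ∪ B₂) ×ˢ (B₁ ∪ B₂)) := by
    refine IntegrableOn.congr_fun
      (((integrableOn_log_dist hSc.isBounded hSc.measurableSet).const_mul (-(1 / (2 * π)))).sub
        (hhS.integrableOn_compact (hSc.prod hSc))) ?_
      (hSc.measurableSet.prod hSc.measurableSet)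
    rintro ⟨x, y⟩ ⟨hx, hy⟩
    exact (hGdef x (hSD hx) y (hSD hy)).symm
  have hlower : ∀ x ∈ B₁ ∪ B₂, ∀ y ∈ B₁ ∪ B₂, ∀ l, log (dist x y) ≤ l →
      -(1 / (2 * π)) * l - K ≤ G x y := by
    intro x hx y hy l hl
    rw [hGdef x (hSD hx) y (hSD hy)]
    have := (abs_le.1 (hK' x hx y hy)).2
    have := mul_le_mul_of_nonneg_left hl (by positivity : 0 ≤ 1 / (2 * π))
    linarith
  have hupper : ∀ x ∈ B₁ ∪ B₂, ∀ y ∈ B₁ ∪ B₂, |log (dist x y)| ≤ N →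
      G x y ≤ 1 / (2 * π) * N + K := by
    intro x hx y hy hl
    rw [hGdef x (hSD hx) y (hSD hy)]
    have := (abs_le.1 (hK' x hx y hy)).1
    have := mul_le_mul_of_nonneg_left (abs_le.1 hl).1 (by positivity : 0 ≤ 1 / (2 * π))
    linarith
  have hκ2' : 0 < -κ2 := neg_pos.2 hκ2
  set M := 1 / (2 * π) * N + K with hM
  set C₀ := (1 / 2) * ((1 / (2 * π) * log 2 + K) * (κ1 ^ 2 + κ2 ^ 2) + 2 * M * (κ1 * -κ2))
    with hC₀
  refine ⟨κ1 / (π * δ ^ 2) + -κ2 / (π * δ ^ 2), by positivity, |C₀| + 1, by positivity,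
    fun lam hlam => ?_⟩
  have hq₁ : 0 < κ1 / (π * δ ^ 2) := by positivity
  have hq₂ : 0 < -κ2 / (π * δ ^ 2) := by positivity
  have hlam0 : 0 < lam := by linarith
  have hr₁ : √(κ1 / (lam * π)) ≤ δ := sqrt_div_mul_pi_le hδ hlam0 (by linarith)
  have hr₂ : √(-κ2 / (lam * π)) ≤ δ := sqrt_div_mul_pi_le hδ hlam0 (by linarith)
  have hA₁ : closedBall xb1 (√(κ1 / (lam * π))) ⊆ B₁ := closedBall_subset_closedBall hr₁
  have hA₂ : closedBall xb2 (√(-κ2 / (lam * π))) ⊆ B₂ := closedBall_subset_closedBall hr₂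
  have hI₁ := setIntegral_patch hκ1.le hlam0 (hA₁.trans hB1D)
  have hI₂ := setIntegral_patch hκ2'.le hlam0 (hA₂.trans hB2D)
  have hε₁ : 0 < √(κ1 / (lam * π)) := by positivity
  have hε₂ : 0 < √(-κ2 / (lam * π)) := by positivity
  set ε₁ := √(κ1 / (lam * π))
  set ε₂ := √(-κ2 / (lam * π))
  refine ⟨⟨hr₁, hr₂⟩, patch xb1 ε₁ lam - patch xb2 ε₂ lam, ?_, ?_⟩
  · refine ⟨patch xb1 ε₁ lam, -patch xb2 ε₂ lam, by rw [sub_eq_add_neg],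
      measurable_patch _ _ _, (measurable_patch _ _ _).neg,
      Eventually.of_forall fun x => ⟨patch_nonneg _ _ hlam0.le x, patch_le _ _ hlam0.le x⟩,
      Eventually.of_forall fun x => ⟨neg_le_neg (patch_le _ _ hlam0.le x),
        neg_nonpos.2 (patch_nonneg _ _ hlam0.le x)⟩, hI₁, ?_,
      Eventually.of_forall fun x hx => patch_eq_zero fun hx' => hx (hA₁ hx'),
      Eventually.of_forall fun x hx => ?_⟩
    · simp only [Pi.neg_apply, integral_neg, hI₂, neg_neg]
    · rw [Pi.neg_apply, patch_eq_zero fun hx' => hx (hA₂ hx'), neg_zero]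
  · refine le_trans ?_ (le_energy_patch_sub_patch (M := M) hlam0.le
      (hGS.mono_set (prod_mono (union_subset_union hA₁ hA₂) (union_subset_union hA₁ hA₂)))
      hI₁ hI₂
      (fun x hx y hy hne => hlower x (Or.inl (hA₁ hx)) y (Or.inl (hA₁ hy)) _
        (log_dist_le_of_mem_closedBall hε₁ hx hy hne))
      (fun x hx y hy hne => hlower x (Or.inr (hA₂ hx)) y (Or.inr (hA₂ hy)) _
        (log_dist_le_of_mem_closedBall hε₂ hx hy hne))
      (fun x hx y hy => hupper x (Or.inl (hA₁ hx)) y (Or.inr (hA₂ hy))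
        (hN' x (hA₁ hx) y (hA₂ hy)))
      (fun x hx y hy => hupper x (Or.inr (hA₂ hx)) y (Or.inl (hA₁ hy))
        (dist_comm x y ▸ hN' y (hA₁ hy) x (hA₂ hx))))
    have hC := le_abs_self C₀
    have hsplit : (1 / 2) * ((-(1 / (2 * π)) * (log 2 + log ε₁) - K) * κ1 ^ 2
          + (-(1 / (2 * π)) * (log 2 + log ε₂) - K) * (-κ2) ^ 2 - 2 * M * (κ1 * -κ2))
        = -(1 / (4 * π)) * (κ1 ^ 2 * log ε₁ + κ2 ^ 2 * log ε₂) - C₀ := by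
      rw [hC₀]
      field_simp
      ring
    rw [hsplit]
    linarith
end
end

section
/- Assume G(x,y) = −(1/(2π)) ln|x−y| − h(x,y) with h : D × D → ℝ continuous. For each large λ let ω^λ ∈ K_λ have the profile ω_i^λ = sgn(κ_i)·λ·1_{Ω_i} with Ω_i = {x ∈ B_i : sgn(κ_i) ψ^λ(x) > μ_i^λ}, where ψ^λ(x) = ∫_D G(x,y) ω^λ(y) dy, and assume the bound |κ₁| μ₁^λ + |κ₂| μ₂^λ ≥ −(1/(2π))·(κ₁² ln ε₁ + κ₂² ln ε₂) − C₀ with C₀ independent of λ, where ε_i = √(|κ_i|/(λπ)). Then there exist R > 1 and λ₀ > 0 such that for every λ ≥ λ₀ and i = 1,2, the diameter of the (essential) support of ω_i^λ is strictly less than R·ε_i. -/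
open MeasureTheory Metric Set Filter Topology Real

noncomputable section

/-- The positive part of `-log ‖z‖` is integrable on the plane. -/
theorem integrable_posLog_norm_inv : Integrable (fun z : Pt => posLog (‖z‖⁻¹)) := by
  rw [integrable_fun_norm_addHaar volume (f := fun r : ℝ => posLog r⁻¹)]
  have hzero : ∀ y ∈ Ioi (1 : ℝ),
      y ^ (Module.finrank ℝ Pt - 1) • posLog y⁻¹ = 0 := by
    intro y hy
    have : posLog y⁻¹ = 0 := by
      rw [posLog_eq_zero_iff, abs_of_nonneg (inv_nonneg.2 (zero_le_one.trans hy.le))]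
      exact inv_le_one_of_one_le₀ hy.le
    simp [this]
  have heq : ∀ y ∈ Ioc (0 : ℝ) 1,
      -(y * Real.log y) = y ^ (Module.finrank ℝ Pt - 1) • posLog y⁻¹ := by
    intro y hy
    have : posLog y⁻¹ = -Real.log y := by
      rw [posLog_eq_log, Real.log_inv]
      rw [abs_of_nonneg (inv_nonneg.2 hy.1.le)]
      exact (one_le_inv₀ hy.1).2 hy.2
    simp [this]
  rw [← Ioc_union_Ioi_eq_Ioi zero_le_one]
  refine IntegrableOn.union ?_ ?_
  · refine IntegrableOn.congr_fun ?_ heq measurableSet_Ioc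
    exact (continuous_mul_log.neg.continuousOn.integrableOn_compact isCompact_Icc).mono_set
      Ioc_subset_Icc_self
  · exact IntegrableOn.congr_fun integrableOn_zero (fun y hy => (hzero y hy).symm)
      measurableSet_Ioi

theorem integrable_posLog_rescaled (x : Pt) {ε : ℝ} (hε : 0 < ε) :
    Integrable (fun y : Pt => posLog (‖ε⁻¹ • (y - x)‖⁻¹)) :=
  (integrable_posLog_norm_inv.comp_smul (inv_ne_zero hε.ne')).comp_sub_right x

theorem integral_posLog_rescaled (x : Pt) {ε : ℝ} (hε : 0 < ε) :
    ∫ y : Pt, posLog (‖ε⁻¹ • (y - x)‖⁻¹) = ε ^ 2 * ∫ z : Pt, posLog (‖z‖⁻¹) := by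
  rw [integral_sub_right_eq_self (fun y : Pt => posLog (‖ε⁻¹ • y‖⁻¹)) x,
    Measure.integral_comp_inv_smul_of_nonneg volume (fun z : Pt => posLog (‖z‖⁻¹)) hε.le]
  simp

theorem log_sub_log_dist_le (x : Pt) {ε : ℝ} (hε : 0 < ε) {y : Pt} (hy : y ≠ x) :
    Real.log ε - Real.log (dist x y) ≤ posLog (‖ε⁻¹ • (y - x)‖⁻¹) := by
  have hd : 0 < dist x y := dist_pos.2 hy.symm
  have : ‖ε⁻¹ • (y - x)‖⁻¹ = ε / dist x y := by
    rw [norm_smul, norm_inv, Real.norm_of_nonneg hε.le, ← dist_eq_norm, dist_comm y x]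
    field_simp
  rw [this, ← Real.log_div hε.ne' hd.ne', posLog_apply]
  exact le_max_right _ _

theorem integrableOn_log_dist_s10 (x : Pt) {s : Set Pt} (hs : Bornology.IsBounded s) :
    IntegrableOn (fun y => Real.log (dist x y)) s := by
  obtain ⟨r, hr⟩ := hs.subset_closedBall x
  refine IntegrableOn.mono_set ?_ hr
  have h1 : IntegrableOn (fun y : Pt => posLog (dist x y)) (closedBall x r) :=
    (Continuous.continuousOn (by fun_prop)).integrableOn_compact (isCompact_closedBall x r)
  have h2 := (integrable_posLog_rescaled x one_pos).integrableOn (s := closedBall x r)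
  refine (h1.sub h2).congr (.of_forall fun y => ?_)
  simp only [Pi.sub_apply, inv_one, one_smul, ← dist_eq_norm, dist_comm y x]
  exact posLog_sub_posLog_inv

theorem integrableOn_log_sub_log_dist (x : Pt) (c : ℝ) {s : Set Pt}
    (hs : Bornology.IsBounded s) :
    IntegrableOn (fun y => c - Real.log (dist x y)) s :=
  (integrableOn_const hs.measure_lt_top.ne).sub (integrableOn_log_dist_s10 x hs)

/-- The rescaled logarithmic energy over a bounded set is controlled from above, with a gain
proportional to the area of the part of the set far from the pole. -/
theorem integral_log_add_measure_diff_ball_le (x : Pt) {ε R : ℝ} (hε : 0 < ε) (hR : 1 ≤ R)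
    {Ω : Set Pt} (hb : Bornology.IsBounded Ω) :
    (∫ y in Ω, (Real.log ε - Real.log (dist x y))) +
      Real.log R * volume.real (Ω \ ball x (R * ε)) ≤ ε ^ 2 * ∫ z : Pt, posLog (‖z‖⁻¹) := by
  have hR0 : 0 < R := one_pos.trans_le hR
  have hfar : IntegrableOn ((ball x (R * ε))ᶜ.indicator fun _ => Real.log R) Ω :=
    (integrableOn_const hb.measure_lt_top.ne).indicator measurableSet_ball.compl
  have hfi : ∫ y in Ω, (ball x (R * ε))ᶜ.indicator (fun _ => Real.log R) y =
      Real.log R * volume.real (Ω \ ball x (R * ε)) := by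
    rw [setIntegral_indicator measurableSet_ball.compl, setIntegral_const, smul_eq_mul, mul_comm,
      sdiff_eq]
  rw [← hfi, ← integral_add (integrableOn_log_sub_log_dist x _ hb) hfar,
    ← integral_posLog_rescaled x hε]
  refine le_trans ?_ (setIntegral_le_integral (s := Ω) (integrable_posLog_rescaled x hε)
    (.of_forall fun _ => posLog_nonneg))
  refine integral_mono_ae ((integrableOn_log_sub_log_dist x _ hb).add hfar)
    (integrable_posLog_rescaled x hε).integrableOn ?_
  filter_upwards [ae_restrict_of_ae (compl_mem_ae_iff.2 (measure_singleton x))] with y hy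
  by_cases hyb : y ∈ ball x (R * ε)
  · simpa [hyb] using log_sub_log_dist_le x hε hy
  · have hd : R * ε ≤ dist x y := by simpa [dist_comm] using hyb
    have := Real.log_le_log (by positivity) hd
    rw [Real.log_mul hR0.ne' hε.ne'] at this
    have hp : 0 ≤ posLog (‖ε⁻¹ • (y - x)‖⁻¹) := posLog_nonneg
    simp only [mem_compl_iff, hyb, not_false_eq_true, indicator_of_mem]
    linarith

theorem diam_le_of_measure_diff_ball_lt {Ω : Set Pt} (hb : Bornology.IsBounded Ω)
    {r : ℝ} (hr : 0 ≤ r)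
    (h : ∀ x ∈ Ω, volume.real (Ω \ ball x r) < volume.real Ω / 2) : diam Ω ≤ 2 * r := by
  refine diam_le_of_forall_dist_le (by positivity) fun x hx y hy => ?_
  by_contra! hlt
  have hdisj : Disjoint (ball x r) (ball y r) := ball_disjoint_ball (by linarith)
  have hsub : Ω ⊆ (Ω \ ball x r) ∪ (Ω \ ball y r) := by
    intro z hz
    by_cases hzx : z ∈ ball x r
    · exact Or.inr ⟨hz, fun hzy => hdisj.le_bot ⟨hzx, hzy⟩⟩
    · exact Or.inl ⟨hz, hzx⟩
  have hle : volume.real Ω ≤ _ := (measureReal_mono hsub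
    ((hb.subset (union_subset sdiff_subset sdiff_subset)).measure_lt_top.ne)).trans
      (measureReal_union_le _ _)
  linarith [h x hx, h y hy]

/-- If the rescaled logarithmic energy of `Ω`, normalised by `lam * |Ω| = a`, is bounded below at
every point of `Ω`, then `Ω` has diameter comparable to the radius `√(a / (lam π))`. -/
theorem diam_le_of_log_energy_ge {a lam K R : ℝ} (ha : 0 < a) (hlam : 0 < lam) (hR : 1 ≤ R)
    (hlog : 2 * (a / π * (∫ z : Pt, posLog (‖z‖⁻¹)) + K) < Real.log R * a)
    {Ω : Set Pt} (hb : Bornology.IsBounded Ω)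
    (hvol : lam * volume.real Ω = a)
    (hK : ∀ x ∈ Ω, -K ≤ lam * ∫ y in Ω,
      (Real.log (Real.sqrt (a / (lam * π))) - Real.log (dist x y))) :
    diam Ω ≤ 2 * (R * Real.sqrt (a / (lam * π))) := by
  have hε : 0 < Real.sqrt (a / (lam * π)) := Real.sqrt_pos.2 (by positivity)
  refine diam_le_of_measure_diff_ball_lt hb (by positivity) fun x hx => ?_
  have h1 := mul_le_mul_of_nonneg_left
    (integral_log_add_measure_diff_ball_le x hε hR hb) hlam.le
  have h2 : lam * (Real.sqrt (a / (lam * π)) ^ 2 * ∫ z : Pt, posLog (‖z‖⁻¹)) =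
      a / π * ∫ z : Pt, posLog (‖z‖⁻¹) := by
    rw [Real.sq_sqrt (by positivity)]
    field_simp
  rw [h2, mul_add] at h1
  have h3 := hK x hx
  have hlogR : 0 ≤ Real.log R := Real.log_nonneg hR
  by_contra! hcon
  have h4 : Real.log R * (volume.real Ω / 2) ≤
      Real.log R * volume.real (Ω \ ball x (R * Real.sqrt (a / (lam * π)))) :=
    mul_le_mul_of_nonneg_left hcon hlogR
  have h5 := mul_le_mul_of_nonneg_left h4 hlam.le
  have h6 : lam * (Real.log R * (volume.real Ω / 2)) = Real.log R * a / 2 := by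
    rw [← hvol]; ring
  linarith

section Green

variable {D : Set Pt} {h G : Pt → Pt → ℝ}

theorem integrableOn_green (hh : ContinuousOn (fun p : Pt × Pt => h p.1 p.2) (D ×ˢ D))
    (hGdef : ∀ x ∈ D, ∀ y ∈ D, G x y = -(1 / (2 * π)) * Real.log (dist x y) - h x y)
    {K : Set Pt} (hK : IsCompact K) (hKD : K ⊆ D) {x : Pt} (hx : x ∈ D) :
    IntegrableOn (G x) K := by
  have hcont : ContinuousOn (h x) K :=
    hh.comp (f := fun y => (x, y)) (by fun_prop) fun y hy => ⟨hx, hKD hy⟩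
  exact IntegrableOn.congr_fun (((integrableOn_log_dist_s10 x hK.isBounded).const_mul _).sub
    (hcont.integrableOn_compact hK)) (fun y hy => (hGdef x hx y (hKD hy)).symm)
    hK.measurableSet

theorem exists_abs_le_of_continuousOn
    (hh : ContinuousOn (fun p : Pt × Pt => h p.1 p.2) (D ×ˢ D)) {K : Set Pt} (hK : IsCompact K)
    (hKD : K ⊆ D) : ∃ C, ∀ x ∈ K, ∀ y ∈ K, |h x y| ≤ C := by
  obtain ⟨C, hC⟩ := (hK.prod hK).exists_bound_of_continuousOn (hh.mono (prod_mono hKD hKD))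
  exact ⟨C, fun x hx y hy => hC (x, y) ⟨hx, hy⟩⟩

theorem exists_abs_green_le (hh : ContinuousOn (fun p : Pt × Pt => h p.1 p.2) (D ×ˢ D))
    (hGdef : ∀ x ∈ D, ∀ y ∈ D, G x y = -(1 / (2 * π)) * Real.log (dist x y) - h x y)
    {K K' : Set Pt} (hK : IsCompact K) (hK' : IsCompact K') (hKD : K ⊆ D) (hKD' : K' ⊆ D)
    (hdisj : Disjoint K K') : ∃ C, ∀ x ∈ K, ∀ y ∈ K', |G x y| ≤ C := by
  have hcont : ContinuousOn
      (fun p : Pt × Pt => -(1 / (2 * π)) * Real.log (dist p.1 p.2) - h p.1 p.2) (K ×ˢ K') := by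
    refine ContinuousOn.sub (continuousOn_const.mul (ContinuousOn.log (by fun_prop) ?_))
      (hh.mono (prod_mono hKD hKD'))
    rintro ⟨x, y⟩ ⟨hx, hy⟩
    exact dist_ne_zero.2 (hdisj.ne_of_mem hx hy)
  obtain ⟨C, hC⟩ := (hK.prod hK').exists_bound_of_continuousOn hcont
  refine ⟨C, fun x hx y hy => ?_⟩
  rw [hGdef x (hKD hx) y (hKD' hy)]
  exact hC (x, y) ⟨hx, hy⟩

/-- The potential of a pair of patches, evaluated in the patch `Ω`, is bounded by the logarithmic
self-energy of `Ω` up to bounded terms. -/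
theorem integral_green_mul_le (hh : ContinuousOn (fun p : Pt × Pt => h p.1 p.2) (D ×ˢ D))
    (hGdef : ∀ x ∈ D, ∀ y ∈ D, G x y = -(1 / (2 * π)) * Real.log (dist x y) - h x y)
    {K K' : Set Pt} (hK : IsCompact K) (hK' : IsCompact K') (hKD : K ⊆ D) (hKD' : K' ⊆ D)
    {H T : ℝ} (hH : ∀ x ∈ K, ∀ y ∈ K, |h x y| ≤ H) (hT : ∀ x ∈ K, ∀ y ∈ K', |G x y| ≤ T)
    {Ω Ω' : Set Pt} (hΩ : MeasurableSet Ω) (hΩ' : MeasurableSet Ω') (hΩK : Ω ⊆ K)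
    (hΩK' : Ω' ⊆ K') {lam a a' : ℝ} (hlam : 0 ≤ lam) (ha : lam * volume.real Ω = a)
    (ha' : lam * volume.real Ω' = a') (c : ℝ) {x : Pt} (hx : x ∈ K) :
    ∫ y in D, G x y * (Ω.indicator (fun _ => lam) y - Ω'.indicator (fun _ => lam) y) ≤
      1 / (2 * π) * (lam * (∫ y in Ω, (c - Real.log (dist x y))) - a * c) + H * a + T * a' := by
  have hGΩ : IntegrableOn (G x) Ω := (integrableOn_green hh hGdef hK hKD (hKD hx)).mono_set hΩK
  have hGΩ' : IntegrableOn (G x) Ω' :=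
    (integrableOn_green hh hGdef hK' hKD' (hKD hx)).mono_set hΩK'
  have hfin : volume Ω ≠ ⊤ := (hK.isBounded.subset hΩK).measure_lt_top.ne
  have hfin' : volume Ω' ≠ ⊤ := (hK'.isBounded.subset hΩK').measure_lt_top.ne
  have hlog := integrableOn_log_dist_s10 x (hK.isBounded.subset hΩK)
  have hsplit : ∀ y, G x y * (Ω.indicator (fun _ => lam) y - Ω'.indicator (fun _ => lam) y) =
      Ω.indicator (fun y => lam * G x y) y - Ω'.indicator (fun y => lam * G x y) y := by
    intro y
    by_cases h1 : y ∈ Ω <;> by_cases h2 : y ∈ Ω' <;> simp [h1, h2, mul_comm]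
  simp_rw [hsplit]
  rw [integral_sub ((integrable_indicator_iff hΩ).2 (hGΩ.const_mul lam)).integrableOn
      ((integrable_indicator_iff hΩ').2 (hGΩ'.const_mul lam)).integrableOn,
    setIntegral_indicator hΩ, setIntegral_indicator hΩ',
    inter_eq_right.2 (hΩK.trans hKD), inter_eq_right.2 (hΩK'.trans hKD'),
    integral_const_mul, integral_const_mul]
  have hself : ∫ y in Ω, G x y ≤ ∫ y in Ω, (-(1 / (2 * π)) * Real.log (dist x y) + H) := by
    refine setIntegral_mono_on hGΩ ((hlog.const_mul _).add (integrableOn_const hfin)) hΩ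
      fun y hy => ?_
    rw [hGdef x (hKD hx) y (hKD (hΩK hy))]
    linarith [neg_le_of_abs_le (hH x hx y (hΩK hy))]
  have hcross : ∫ y in Ω', -T ≤ ∫ y in Ω', G x y :=
    setIntegral_mono_on (integrableOn_const hfin') hGΩ' hΩ' fun y hy =>
      neg_le_of_abs_le (hT x hx y (hΩK' hy))
  rw [integral_add (hlog.const_mul _)
      (show Integrable (fun _ => H) (volume.restrict Ω) from integrableOn_const hfin), integral_const_mul,
    setIntegral_const, smul_eq_mul] at hself
  rw [setIntegral_const, smul_eq_mul] at hcross
  rw [integral_sub (show Integrable (fun _ => c) (volume.restrict Ω) from integrableOn_const hfin)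
    hlog, setIntegral_const, smul_eq_mul]
  have h1 := mul_le_mul_of_nonneg_left hself hlam
  have h2 := mul_le_mul_of_nonneg_left hcross hlam
  rw [← ha, ← ha']
  linarith [h1, h2]

end Green

theorem mul_integral_log_le {a lam : ℝ} (ha : 0 < a) (hlam : 0 < lam) {Ω : Set Pt}
    (hb : Bornology.IsBounded Ω) (x : Pt) :
    lam * ∫ y in Ω, (Real.log (Real.sqrt (a / (lam * π))) - Real.log (dist x y)) ≤
      a / π * ∫ z : Pt, posLog (‖z‖⁻¹) := by
  have hε : 0 < Real.sqrt (a / (lam * π)) := Real.sqrt_pos.2 (by positivity)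
  have h1 := integral_log_add_measure_diff_ball_le x hε le_rfl hb
  rw [Real.log_one, zero_mul, add_zero, Real.sq_sqrt (by positivity)] at h1
  refine (mul_le_mul_of_nonneg_left h1 hlam.le).trans_eq ?_
  field_simp

theorem exists_log_scale_lt {a b A B : ℝ} (ha : 0 < a) (hb : 0 < b) :
    ∃ R, 1 ≤ R ∧ A < Real.log R * a ∧ B < Real.log R * b := by
  refine ⟨Real.exp (|A / a| + |B / b| + 1), Real.one_le_exp (by positivity), ?_, ?_⟩
  · rw [Real.log_exp, ← div_lt_iff₀ ha]
    linarith [le_abs_self (A / a), abs_nonneg (B / b)]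
  · rw [Real.log_exp, ← div_lt_iff₀ hb]
    linarith [le_abs_self (B / b), abs_nonneg (A / a)]

theorem neg_div_le_of_weighted_sum_ge {a b F M U V : ℝ} (ha : 0 < a) (hb : 0 ≤ b)
    (hsum : -F ≤ a * U + b * V) (hV : V ≤ M) : -((F + b * M) / a) ≤ U := by
  rw [← neg_div, div_le_iff₀ ha]
  linarith [mul_le_mul_of_nonneg_left hV hb]

theorem stmt10
    (D : Set Pt) (hDo : IsOpen D) (hDb : Bornology.IsBounded D)
    (xb1 xb2 : Pt) (hx : xb1 ≠ xb2) (δ : ℝ) (hδ : 0 < δ)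
    (hB1D : closedBall xb1 δ ⊆ D) (hB2D : closedBall xb2 δ ⊆ D)
    (hBdisj : Disjoint (closedBall xb1 δ) (closedBall xb2 δ))
    (κ1 κ2 : ℝ) (hκ1 : 0 < κ1) (hκ2 : κ2 < 0)
    (h : Pt → Pt → ℝ)
    (hh : ContinuousOn (fun p : Pt × Pt => h p.1 p.2) (D ×ˢ D))
    (G : Pt → Pt → ℝ)
    (hGdef : ∀ x ∈ D, ∀ y ∈ D, G x y = -(1 / (2 * π)) * Real.log (dist x y) - h x y)
    (lam1 : ℝ) (hlam1 : 0 < lam1)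
    (μ1 μ2 : ℝ → ℝ) (ψ : ℝ → Pt → ℝ) (ω1 ω2 : ℝ → Pt → ℝ)
    (hω1 : ∀ lam : ℝ,
      ω1 lam = Set.indicator {x ∈ closedBall xb1 δ | μ1 lam < ψ lam x} (fun _ => lam))
    (hω2 : ∀ lam : ℝ,
      ω2 lam = Set.indicator {x ∈ closedBall xb2 δ | ψ lam x < -(μ2 lam)} (fun _ => -lam))
    (hψdef : ∀ lam : ℝ, lam1 ≤ lam → ∀ x,
      ψ lam x = ∫ y in D, G x y * (ω1 lam y + ω2 lam y))
    (hadm : ∀ lam : ℝ, lam1 ≤ lam →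
      IsAdmissiblePair D (closedBall xb1 δ) (closedBall xb2 δ) κ1 κ2 lam (ω1 lam) (ω2 lam))
    (C0 : ℝ)
    (hμbound : ∀ lam : ℝ, lam1 ≤ lam →
      -(1 / (2 * π)) * (κ1 ^ 2 * Real.log (Real.sqrt (κ1 / (lam * π)))
          + κ2 ^ 2 * Real.log (Real.sqrt (-κ2 / (lam * π)))) - C0 ≤
        κ1 * μ1 lam + (-κ2) * μ2 lam) :
    ∃ R > 1, ∃ lam0, lam1 ≤ lam0 ∧ ∀ lam : ℝ, lam0 ≤ lam →
      Metric.diam (Function.support (ω1 lam)) < R * Real.sqrt (κ1 / (lam * π)) ∧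
      Metric.diam (Function.support (ω2 lam)) < R * Real.sqrt (-κ2 / (lam * π)) := by
  obtain ⟨b, rfl⟩ : ∃ b, κ2 = -b := ⟨-κ2, (neg_neg _).symm⟩
  have hb : 0 < b := by linarith
  simp only [neg_neg, neg_sq] at hμbound ⊢
  have hK1 := isCompact_closedBall xb1 δ
  have hK2 := isCompact_closedBall xb2 δ
  obtain ⟨H1, hH1⟩ := exists_abs_le_of_continuousOn hh hK1 hB1D
  obtain ⟨H2, hH2⟩ := exists_abs_le_of_continuousOn hh hK2 hB2D
  obtain ⟨T1, hT1⟩ := exists_abs_green_le hh hGdef hK1 hK2 hB1D hB2D hBdisj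
  obtain ⟨T2, hT2⟩ := exists_abs_green_le hh hGdef hK2 hK1 hB2D hB1D hBdisj.symm
  set M := ∫ z : Pt, posLog (‖z‖⁻¹)
  set F := 2 * π * (C0 + κ1 * (H1 * κ1 + T1 * b) + b * (H2 * b + T2 * κ1)) with hF
  obtain ⟨R, hR, hRa, hRb⟩ := exists_log_scale_lt
    (A := 2 * (κ1 / π * M + (F + b * (b / π * M)) / κ1))
    (B := 2 * (b / π * M + (F + κ1 * (κ1 / π * M)) / b)) hκ1 hb
  refine ⟨3 * R, by linarith, lam1, le_rfl, fun lam hlam => ?_⟩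
  have hlam0 : 0 < lam := hlam1.trans_le hlam
  obtain ⟨hm1, hm2, -, -, hi1, hi2, -, -⟩ := hadm lam hlam
  set Ω1 := {x ∈ closedBall xb1 δ | μ1 lam < ψ lam x} with hΩ1
  set Ω2 := {x ∈ closedBall xb2 δ | ψ lam x < -(μ2 lam)} with hΩ2
  have hs1 : Ω1 ⊆ closedBall xb1 δ := fun x hx => hx.1
  have hs2 : Ω2 ⊆ closedBall xb2 δ := fun x hx => hx.1
  have hbd1 : Bornology.IsBounded Ω1 := isBounded_closedBall.subset hs1
  have hbd2 : Bornology.IsBounded Ω2 := isBounded_closedBall.subset hs2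
  rw [hω1 lam] at hm1 hi1 ⊢
  rw [hω2 lam] at hm2 hi2 ⊢
  have hmΩ1 : MeasurableSet Ω1 :=
    haveI : NeZero lam := ⟨hlam0.ne'⟩
    (measurable_indicator_const_iff lam).1 hm1
  have hmΩ2 : MeasurableSet Ω2 :=
    haveI : NeZero (-lam) := ⟨neg_ne_zero.2 hlam0.ne'⟩
    (measurable_indicator_const_iff (-lam)).1 hm2
  rw [setIntegral_indicator hmΩ1, inter_eq_right.2 (hs1.trans hB1D), setIntegral_const,
    smul_eq_mul, mul_comm] at hi1
  rw [setIntegral_indicator hmΩ2, inter_eq_right.2 (hs2.trans hB2D), setIntegral_const,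
    smul_eq_mul, mul_neg, neg_inj, mul_comm] at hi2
  have hne1 : Ω1.Nonempty := by
    rw [nonempty_iff_ne_empty]
    intro h0
    simp only [h0, measureReal_empty, mul_zero] at hi1
    linarith
  have hne2 : Ω2.Nonempty := by
    rw [nonempty_iff_ne_empty]
    intro h0
    simp only [h0, measureReal_empty, mul_zero] at hi2
    linarith
  set ε1 := Real.sqrt (κ1 / (lam * π))
  set ε2 := Real.sqrt (b / (lam * π))
  have hε1pos : 0 < ε1 := Real.sqrt_pos.2 (by positivity)
  have hε2pos : 0 < ε2 := Real.sqrt_pos.2 (by positivity)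
  have hψ : ∀ x, ψ lam x =
      ∫ y in D, G x y * (Ω1.indicator (fun _ => lam) y - Ω2.indicator (fun _ => lam) y) := by
    intro x
    rw [hψdef lam hlam x, hω1 lam, hω2 lam]
    refine integral_congr_ae (.of_forall fun y => ?_)
    simp only [indicator_neg, ← hΩ1, ← hΩ2, sub_eq_add_neg]
  have hψneg : ∀ x, -ψ lam x =
      ∫ y in D, G x y * (Ω2.indicator (fun _ => lam) y - Ω1.indicator (fun _ => lam) y) := by
    intro x
    rw [hψ x, ← integral_neg]
    refine integral_congr_ae (.of_forall fun y => ?_)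
    simp only
    ring
  have hsum : ∀ x ∈ Ω1, ∀ z ∈ Ω2,
      -F ≤ κ1 * (lam * ∫ y in Ω1, (Real.log ε1 - Real.log (dist x y))) +
        b * (lam * ∫ y in Ω2, (Real.log ε2 - Real.log (dist z y))) := by
    intro x hxΩ z hzΩ
    have h1 := integral_green_mul_le hh hGdef hK1 hK2 hB1D hB2D hH1 hT1 hmΩ1 hmΩ2 hs1 hs2
      hlam0.le hi1 hi2 (Real.log ε1) (hs1 hxΩ)
    have h2 := integral_green_mul_le hh hGdef hK2 hK1 hB2D hB1D hH2 hT2 hmΩ2 hmΩ1 hs2 hs1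
      hlam0.le hi2 hi1 (Real.log ε2) (hs2 hzΩ)
    rw [← hψ] at h1
    rw [← hψneg] at h2
    have h3 := mul_le_mul_of_nonneg_left (hxΩ.2.le.trans h1) hκ1.le
    have h4 := mul_le_mul_of_nonneg_left ((lt_neg_of_lt_neg hzΩ.2).le.trans h2) hb.le
    have h5 := hμbound lam hlam
    set U := lam * ∫ y in Ω1, (Real.log ε1 - Real.log (dist x y))
    set V := lam * ∫ y in Ω2, (Real.log ε2 - Real.log (dist z y))
    have h6 : 0 ≤ 1 / (2 * π) * (κ1 * U + b * V + F) := by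
      have hF' : 1 / (2 * π) * F =
          C0 + κ1 * (H1 * κ1 + T1 * b) + b * (H2 * b + T2 * κ1) := by
        rw [hF]; field_simp
      rw [mul_add, hF']
      linarith
    have h7 := nonneg_of_mul_nonneg_right h6 (by positivity)
    linarith
  obtain ⟨x0, hx0⟩ := hne1
  obtain ⟨z0, hz0⟩ := hne2
  have hd1 : diam Ω1 ≤ 2 * (R * ε1) :=
    diam_le_of_log_energy_ge hκ1 hlam0 hR hRa hbd1 hi1 fun x hxΩ =>
      neg_div_le_of_weighted_sum_ge hκ1 hb.le (hsum x hxΩ z0 hz0)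
        (mul_integral_log_le hb hlam0 hbd2 z0)
  have hd2 : diam Ω2 ≤ 2 * (R * ε2) :=
    diam_le_of_log_energy_ge hb hlam0 hR hRb hbd2 hi2 fun z hzΩ =>
      neg_div_le_of_weighted_sum_ge hb hκ1.le ((hsum x0 hx0 z hzΩ).trans_eq (add_comm _ _))
        (mul_integral_log_le hκ1 hlam0 hbd1 x0)
  rw [support_indicator, support_indicator,
    Function.support_const hlam0.ne', Function.support_const (neg_ne_zero.2 hlam0.ne'),
    inter_univ, inter_univ]
  have hRpos : 0 < R := one_pos.trans_le hR
  constructor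
  · linarith [mul_pos hRpos hε1pos]
  · linarith [mul_pos hRpos hε2pos]
end
end

section
/- Assume G ∈ L¹(D × D) is symmetric (G(x,y) = G(y,x)). Let ω^λ ∈ K_λ be a maximizer of E over K_λ whose stream function ψ^λ(x) = ∫_D G(x,y) ω^λ(y) dy is of class C¹ on D, and suppose the support of ω_i^λ has strictly positive distance to the boundary ∂B_i for i = 1,2. Then ω^λ is a weak steady solution of the two-dimensional Euler vorticity equation: for every test function ξ ∈ C_c^∞(D), ∫_D ω^λ(x) · (∂₁ξ(x) ∂₂ψ^λ(x) − ∂₂ξ(x) ∂₁ψ^λ(x)) dx = 0. -/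
open MeasureTheory Metric Set Filter Topology Real

noncomputable section

/-- The bathtub principle: a bounded density that is optimal among its mass-preserving
perturbations is saturated above some level of the potential and vanishes below it. -/
lemma exists_level_of_maximizer {α : Type*} [MeasurableSpace α] {μ : Measure α}
    [IsFiniteMeasure μ] {p ω : α → ℝ} {lam C : ℝ} (hp : Measurable p) (hω : Measurable ω)
    (hpC : ∀ᵐ x ∂μ, |p x| ≤ C) (hb : ∀ᵐ x ∂μ, 0 ≤ ω x ∧ ω x ≤ lam) (hpos : 0 < ∫ x, ω x ∂μ)
    (H : ∀ η : α → ℝ, Measurable η → (∀ᵐ x ∂μ, 0 ≤ ω x + η x ∧ ω x + η x ≤ lam) →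
      ∫ x, η x ∂μ = 0 → ∫ x, p x * η x ∂μ ≤ 0) :
    ∃ c, ∀ᵐ x ∂μ, (p x < c → ω x = 0) ∧ (c < p x → ω x = lam) := by
  have dichotomy (c : ℝ) : (∀ᵐ x ∂μ, p x < c → ω x = 0) ∨ ∀ᵐ x ∂μ, c < p x → ω x = lam := by
    set f : α → ℝ := {x | p x < c}.indicator ω with hf
    set g : α → ℝ := {x | c < p x}.indicator (fun x ↦ lam - ω x) with hg
    have hfm : Measurable f := hω.indicator (measurableSet_lt hp measurable_const)
    have hgm : Measurable g :=
      (measurable_const.sub hω).indicator (measurableSet_lt measurable_const hp)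
    have hfb : ∀ᵐ x ∂μ, 0 ≤ f x ∧ f x ≤ ω x := by
      filter_upwards [hb] with x hx
      by_cases h : p x < c <;> simp [hf, h, hx.1]
    have hgb : ∀ᵐ x ∂μ, 0 ≤ g x ∧ g x ≤ lam - ω x := by
      filter_upwards [hb] with x hx
      by_cases h : c < p x <;> simp [hg, h, hx.2]
    have hfi : Integrable f μ := by
      refine .of_bound hfm.aestronglyMeasurable lam ?_
      filter_upwards [hfb, hb] with x h1 h2
      rw [Real.norm_eq_abs, abs_of_nonneg h1.1]; linarith
    have hgi : Integrable g μ := by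
      refine .of_bound hgm.aestronglyMeasurable lam ?_
      filter_upwards [hgb, hb] with x h1 h2
      rw [Real.norm_eq_abs, abs_of_nonneg h1.1]; linarith
    set F := ∫ x, f x ∂μ with hF
    set M := ∫ x, g x ∂μ with hM
    have hF0 : 0 ≤ F := integral_nonneg_of_ae (hfb.mono fun x hx ↦ hx.1)
    have hM0 : 0 ≤ M := integral_nonneg_of_ae (hgb.mono fun x hx ↦ hx.1)
    have left_of (h : ∀ᵐ x ∂μ, f x = 0) : ∀ᵐ x ∂μ, p x < c → ω x = 0 := by
      filter_upwards [h] with x hx hxc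
      simpa [hf, hxc] using hx
    rcases hF0.eq_or_lt' with hF0 | hF0
    · exact .inl (left_of ((integral_eq_zero_iff_of_nonneg_ae
        (hfb.mono fun x hx ↦ hx.1) hfi).1 hF0))
    rcases hM0.eq_or_lt' with hM0 | hM0
    · right
      filter_upwards [(integral_eq_zero_iff_of_nonneg_ae
        (hgb.mono fun x hx ↦ hx.1) hgi).1 hM0] with x hx hxc
      have : lam - ω x = 0 := by simpa [hg, hxc] using hx
      linarith
    left
    set a := M / (F + M)
    set b := F / (F + M)
    have ha : 0 < a := by positivity
    have hb' : 0 < b := by positivity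
    have hab : a + b = 1 := by simp only [a, b]; field_simp; ring
    have habFM : a * F = b * M := by simp only [a, b]; ring
    set η : α → ℝ := fun x ↦ b * g x - a * f x with hη
    have hηi : Integrable η μ := (hgi.const_mul b).sub (hfi.const_mul a)
    have hη0 : ∫ x, η x ∂μ = 0 := by
      rw [hη, integral_sub (hgi.const_mul b) (hfi.const_mul a), integral_const_mul,
        integral_const_mul, ← hF, ← hM]
      linarith
    have hpη := H η ((hgm.const_mul b).sub (hfm.const_mul a)) (by
      filter_upwards [hfb, hgb] with x h1 h2
      simp only [hη]
      constructor <;> nlinarith) hη0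
    have hpηi : Integrable (fun x ↦ p x * η x) μ := hηi.bdd_mul hp.aestronglyMeasurable hpC
    have hnn : ∀ᵐ x ∂μ, a * ((c - p x) * f x) ≤ (p x - c) * η x ∧ 0 ≤ (c - p x) * f x := by
      filter_upwards [hfb, hgb] with x h1 h2
      have e1 : 0 ≤ (c - p x) * f x := by
        by_cases h : p x < c
        · exact mul_nonneg (by linarith) h1.1
        · simp [hf, h]
      have e2 : 0 ≤ (p x - c) * g x := by
        by_cases h : c < p x
        · exact mul_nonneg (by linarith) h2.1
        · simp [hg, h]
      refine ⟨?_, e1⟩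
      simp only [hη]
      nlinarith [mul_nonneg hb'.le e2]
    have hsub : (fun x ↦ (p x - c) * η x) = fun x ↦ p x * η x - c * η x := by
      ext x; ring
    have hnn' : 0 ≤ᵐ[μ] fun x ↦ (p x - c) * η x := by
      filter_upwards [hnn] with x hx using (mul_nonneg ha.le hx.2).trans hx.1
    have hz : ∫ x, (p x - c) * η x ∂μ = 0 := by
      refine le_antisymm ?_ (integral_nonneg_of_ae hnn')
      rw [hsub, integral_sub hpηi (hηi.const_mul c), integral_const_mul, hη0]
      linarith
    filter_upwards [(integral_eq_zero_iff_of_nonneg_ae hnn'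
      (by rw [hsub]; exact hpηi.sub (hηi.const_mul c))).1 hz, hnn] with x hx h2 hxc
    have h3 : (c - p x) * f x = 0 := by
      simp only [Pi.zero_apply] at hx
      nlinarith
    have h4 := (mul_eq_zero.1 h3).resolve_left (by linarith)
    simpa [hf, hxc] using h4
  set S : Set ℝ := {c | ∀ᵐ x ∂μ, p x < c → ω x = 0} with hS
  have hne : S.Nonempty := by
    refine ⟨-C, ?_⟩
    filter_upwards [hpC] with x hx h
    linarith [neg_abs_le (p x)]
  have hbdd : BddAbove S := by
    refine ⟨C, fun c hc ↦ ?_⟩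
    by_contra! hcC
    refine hpos.ne' ?_
    rw [integral_congr_ae (g := fun _ ↦ (0 : ℝ)) ?_, integral_zero]
    filter_upwards [hc, hpC] with x h1 h2
    exact h1 (by linarith [le_abs_self (p x)])
  refine ⟨sSup S, ?_⟩
  have hlow : ∀ᵐ x ∂μ, ∀ q : ℚ, (q : ℝ) < sSup S → p x < q → ω x = 0 := by
    refine ae_all_iff.2 fun q ↦ ?_
    by_cases hq : (q : ℝ) < sSup S
    · obtain ⟨c, hc, hqc⟩ := exists_lt_of_lt_csSup hne hq
      filter_upwards [hc] with x hx _ h using hx (h.trans hqc)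
    · exact .of_forall fun x h ↦ absurd h hq
  have hhigh : ∀ᵐ x ∂μ, ∀ q : ℚ, sSup S < q → q < p x → ω x = lam := by
    refine ae_all_iff.2 fun q ↦ ?_
    by_cases hq : sSup S < q
    · have : (q : ℝ) ∉ S := fun h ↦ (le_csSup hbdd h).not_gt hq
      filter_upwards [(dichotomy q).resolve_left this] with x hx _ h using hx h
    · exact .of_forall fun x h ↦ absurd h hq
  filter_upwards [hlow, hhigh] with x h1 h2
  refine ⟨fun h ↦ ?_, fun h ↦ ?_⟩
  · obtain ⟨q, hq1, hq2⟩ := exists_rat_btwn h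
    exact h1 q hq2 hq1
  · obtain ⟨q, hq1, hq2⟩ := exists_rat_btwn h
    exact h2 q hq1 hq2

/-- A Lipschitz function on a closed ball which vanishes on the sphere stays Lipschitz when it is
extended by zero. -/
lemma LipschitzOnWith.indicator_closedBall {E : Type*} [NormedAddCommGroup E] [NormedSpace ℝ E]
    {C : NNReal} {f : E → ℝ} {x₀ : E} {r : ℝ} (hf : LipschitzOnWith C f (closedBall x₀ r))
    (h0 : ∀ z ∈ sphere x₀ r, f z = 0) : LipschitzWith C ((closedBall x₀ r).indicator f) := by
  have key : ∀ x ∈ closedBall x₀ r, ∀ y ∉ closedBall x₀ r, |f x| ≤ C * dist x y := by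
    intro x hx y hy
    rw [mem_closedBall] at hx hy
    obtain ⟨t, ht, hz⟩ := intermediate_value_Icc (zero_le_one (α := ℝ))
      (f := fun t : ℝ ↦ dist (AffineMap.lineMap x y t) x₀) (by fun_prop)
      (show r ∈ Icc _ _ by simpa using ⟨hx, (not_le.1 hy).le⟩)
    have hle := hf.dist_le_mul x hx (AffineMap.lineMap x y t) (le_of_eq hz)
    rw [h0 _ hz, Real.dist_eq, sub_zero] at hle
    refine hle.trans (mul_le_mul_of_nonneg_left ?_ C.2)
    rw [dist_left_lineMap, Real.norm_eq_abs, abs_of_nonneg ht.1]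
    exact mul_le_of_le_one_left dist_nonneg ht.2
  refine LipschitzWith.of_dist_le_mul fun x y ↦ ?_
  by_cases hx : x ∈ closedBall x₀ r <;> by_cases hy : y ∈ closedBall x₀ r
  · simpa [indicator_of_mem hx, indicator_of_mem hy] using hf.dist_le_mul x hx y hy
  · simpa [indicator_of_mem hx, indicator_of_notMem hy] using key x hx y hy
  · simpa [indicator_of_notMem hx, indicator_of_mem hy, dist_comm, Real.dist_eq]
      using key y hy x hx
  · simp only [indicator_of_notMem hx, indicator_of_notMem hy, dist_self]
    positivity

/-- The Jacobian of a test function and a Lipschitz function has zero integral. -/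
lemma integral_jacobian_eq_zero {ξ h : Pt → ℝ} {C : NNReal} (hξ : ContDiff ℝ (⊤ : ℕ∞) ξ)
    (hξc : HasCompactSupport ξ) (hh : LipschitzWith C h) (u v : Pt) :
    Integrable (fun x ↦ fderiv ℝ ξ x u * lineDeriv ℝ h x v - fderiv ℝ ξ x v * lineDeriv ℝ h x u) ∧
    ∫ x, (fderiv ℝ ξ x u * lineDeriv ℝ h x v - fderiv ℝ ξ x v * lineDeriv ℝ h x u) = 0 := by
  have hD : ContDiff ℝ (⊤ : ℕ∞) (fderiv ℝ ξ) := hξ.fderiv_right (by simp)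
  have hsm (u : Pt) : ContDiff ℝ (⊤ : ℕ∞) (fun x ↦ fderiv ℝ ξ x u) := by fun_prop
  have hcs (u : Pt) : HasCompactSupport (fun x ↦ fderiv ℝ ξ x u) :=
    (hξc.fderiv ℝ).comp_left (g := fun L : Pt →L[ℝ] ℝ ↦ L u) rfl
  have hint (u v : Pt) : Integrable (fun x ↦ fderiv ℝ ξ x u * lineDeriv ℝ h x v) :=
    ((hsm u).continuous.integrable_of_hasCompactSupport (hcs u)).mul_bdd
      (aestronglyMeasurable_lineDeriv hh.continuous _)
      (.of_forall fun x ↦ norm_lineDeriv_le_of_lipschitz ℝ hh)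
  have hparts (u v : Pt) : ∫ x, fderiv ℝ ξ x u * lineDeriv ℝ h x v =
      ∫ x, -(fderiv ℝ (fderiv ℝ ξ) x v u) * h x := by
    obtain ⟨D, hD'⟩ := ContDiff.lipschitzWith_of_hasCompactSupport (hcs u) (hsm u) (by simp)
    have := hh.integral_lineDeriv_mul_eq (μ := volume) hD' (hcs u) v
    simp_rw [mul_comm (fderiv ℝ ξ _ u)]
    rw [this]
    refine integral_congr_ae (.of_forall fun x ↦ ?_)
    have hd : DifferentiableAt ℝ (fderiv ℝ ξ) x := hD.differentiable (by simp) x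
    have : DifferentiableAt ℝ (fun x ↦ fderiv ℝ ξ x u) x := (hsm u).differentiable (by simp) x
    simp only
    rw [this.lineDeriv_eq_fderiv, fderiv_clm_apply hd (by fun_prop)]
    simp
  refine ⟨(hint u v).sub (hint v u), ?_⟩
  rw [integral_sub (hint u v) (hint v u), hparts, hparts, sub_eq_zero]
  congr 1
  ext x
  have := (hξ.contDiffAt (x := x)).isSymmSndFDerivAt (by
    simpa using WithTop.coe_le_coe.2 (le_top : (2 : ℕ∞) ≤ ⊤))
  rw [this.eq u v]

lemma lineDeriv_eq_zero_of_nonneg {E : Type*} [AddCommGroup E] [Module ℝ E] {h : E → ℝ} {x : E}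
    (hnn : ∀ y, 0 ≤ h y) (hx : h x = 0) (v : E) : lineDeriv ℝ h x v = 0 :=
  IsLocalMin.deriv_eq_zero (.of_forall fun t ↦ by simpa [hx] using hnn (x + t • v))

/-- If the mass-constrained density `ω` on a ball maximizes `∫ ψ ω` and stays away from the
sphere, then it is a steady weak solution of the transport equation with stream function `ψ`. -/
lemma integral_jacobian_of_maximizer {D : Set Pt} (hDo : IsOpen D) {x₀ : Pt} {δ : ℝ} (hδ : 0 < δ)
    (hBD : closedBall x₀ δ ⊆ D) {ω ψ ξ : Pt → ℝ} {lam d : ℝ} (hlam : 0 < lam) (hd : 0 < d)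
    (hω : Measurable ω) (hb : ∀ᵐ x ∂(volume.restrict D), 0 ≤ ω x ∧ ω x ≤ lam)
    (hpos : 0 < ∫ x in D, ω x)
    (hoff : ∀ᵐ x ∂(volume.restrict D), x ∉ closedBall x₀ δ → ω x = 0)
    (hdist : ∀ x ∈ Function.support ω, ∀ y ∈ sphere x₀ δ, d ≤ dist x y)
    (hψ : ContDiffOn ℝ 1 ψ D)
    (H : ∀ η : Pt → ℝ, Measurable η → (∀ x ∉ closedBall x₀ δ, η x = 0) →
      (∀ᵐ x ∂(volume.restrict D), 0 ≤ ω x + η x ∧ ω x + η x ≤ lam) →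
      ∫ x in D, η x = 0 → ∫ x in D, ψ x * η x ≤ 0)
    (hξ : ContDiff ℝ (⊤ : ℕ∞) ξ) (hξc : HasCompactSupport ξ) :
    IntegrableOn (fun x ↦ ω x *
      (pderiv2 0 ξ x * pderiv2 1 ψ x - pderiv2 1 ξ x * pderiv2 0 ψ x)) D ∧
    ∫ x in D, ω x * (pderiv2 0 ξ x * pderiv2 1 ψ x - pderiv2 1 ξ x * pderiv2 0 ψ x) = 0 := by
  set U := ball x₀ δ with hU
  set B := closedBall x₀ δ with hB
  have hUB : U ⊆ B := ball_subset_closedBall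
  have hUD : U ⊆ D := hUB.trans hBD
  have hUo : IsOpen U := isOpen_ball
  have hDm : MeasurableSet D := hDo.measurableSet
  have hUm : MeasurableSet U := hUo.measurableSet
  have hψc : ContinuousOn ψ D := hψ.continuousOn
  have hψd : ∀ x ∈ D, DifferentiableAt ℝ ψ x := fun x hx ↦
    (hψ.differentiableOn (by simp)).differentiableAt (hDo.mem_nhds hx)
  have hBc : IsCompact B := isCompact_closedBall _ _
  have hUfin : IsFiniteMeasure (volume.restrict U : Measure Pt) :=
    isFiniteMeasure_restrict.2 measure_ball_lt_top.ne
  have hoffU : ∀ᵐ x ∂(volume.restrict D), x ∉ U → ω x = 0 := by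
    filter_upwards [hoff] with x hx hxU
    by_cases hxB : x ∈ B
    · by_contra h
      have hxs : x ∈ sphere x₀ δ := le_antisymm hxB (not_lt.1 hxU)
      simpa [hd.not_ge] using hdist x h x hxs
    · exact hx hxB
  obtain ⟨K, hK⟩ := hBc.exists_bound_of_continuousOn (hψc.mono hBD)
  obtain ⟨c, hc⟩ : ∃ c, ∀ᵐ x ∂(volume.restrict U),
      (ψ x < c → ω x = 0) ∧ (c < ψ x → ω x = lam) := by
    have hpm : Measurable (B.indicator ψ) := by
      classical
      rw [← piecewise_eq_indicator]
      exact (hψc.mono hBD).measurable_piecewise continuousOn_const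
        isClosed_closedBall.measurableSet
    obtain ⟨c, hc⟩ := exists_level_of_maximizer (μ := volume.restrict U) (p := B.indicator ψ)
      (ω := ω) (lam := lam) (C := K) hpm hω
      (by
        filter_upwards [ae_restrict_mem hUm] with x hx
        simpa [indicator_of_mem (hUB hx)] using hK x (hUB hx))
      (ae_mono (Measure.restrict_mono_set _ hUD) hb)
      (by
        rwa [← setIntegral_eq_of_subset_of_ae_sdiff_eq_zero hDm.nullMeasurableSet hUD]
        filter_upwards [(ae_restrict_iff' hDm).1 hoffU] with x hx h using hx h.1 h.2)
      (fun η hη hηb hη0 ↦ by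
        have h1 := H (U.indicator η) (hη.indicator hUm)
          (fun x hx ↦ indicator_of_notMem (fun h ↦ hx (hUB h)) _)
          (by
            filter_upwards [ae_restrict_of_ae ((ae_restrict_iff' hUm).1 hηb), hb] with x h1 h2
            by_cases hx : x ∈ U
            · simpa [hx] using h1 hx
            · simpa [hx] using h2)
          (by rw [setIntegral_indicator hUm, inter_eq_self_of_subset_right hUD, hη0])
        have h2 : (fun x ↦ ψ x * U.indicator η x) =
            U.indicator (fun x ↦ B.indicator ψ x * η x) := by
          ext x
          by_cases hx : x ∈ U
          · simp [hx, hUB hx]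
          · simp [hx]
        rwa [h2, setIntegral_indicator hUm, inter_eq_self_of_subset_right hUD] at h1)
    refine ⟨c, ?_⟩
    filter_upwards [hc, ae_restrict_mem hUm] with x hx hxU
    simpa [indicator_of_mem (hUB hxU)] using hx
  rw [ae_restrict_iff' hUm] at hc
  have hsph : ∀ z ∈ sphere x₀ δ, ψ z ≤ c := by
    intro z hz
    by_contra! hcz
    have hVo : IsOpen (D ∩ ψ ⁻¹' Ioi c) := hψc.isOpen_inter_preimage hDo isOpen_Ioi
    have hzcl : z ∈ closure U := by
      rw [hU, closure_ball _ hδ.ne']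
      exact sphere_subset_closedBall hz
    have hWo : IsOpen ((ball z d ∩ (D ∩ ψ ⁻¹' Ioi c)) ∩ U) := (isOpen_ball.inter hVo).inter hUo
    have hWne := mem_closure_iff.1 hzcl _ (isOpen_ball.inter hVo)
      ⟨mem_ball_self hd, hBD (sphere_subset_closedBall hz), hcz⟩
    refine hWo.measure_ne_zero volume hWne (measure_eq_zero_iff_ae_notMem.2 ?_)
    filter_upwards [hc] with x hx hxW
    have h1 := (hx hxW.2).2 hxW.1.2.2
    have h2 := hdist x (by simpa [h1] using hlam.ne') z hz
    exact h2.not_gt hxW.1.1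
  set h : Pt → ℝ := B.indicator fun x ↦ max (ψ x - c) 0 with hh
  have hh0 : ∀ x, 0 ≤ h x := fun x ↦ indicator_nonneg (fun _ _ ↦ le_max_right _ _) x
  obtain ⟨L, hL⟩ : ∃ L, LipschitzWith L h := by
    obtain ⟨L, hL⟩ := hBc.exists_bound_of_continuousOn
      ((hψ.continuousOn_fderiv_of_isOpen hDo le_rfl).mono hBD)
    have hlip : LipschitzOnWith L.toNNReal ψ B :=
      Convex.lipschitzOnWith_of_nnnorm_fderiv_le (𝕜 := ℝ) (fun x hx ↦ hψd x (hBD hx))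
        (fun x hx ↦ NNReal.coe_le_coe.1 ((hL x hx).trans (Real.le_coe_toNNReal L))) (convex_closedBall _ _)
    refine ⟨L.toNNReal, LipschitzOnWith.indicator_closedBall
      (LipschitzOnWith.of_dist_le_mul fun x hx y hy ↦ ?_) fun z hz ↦ ?_⟩
    · refine (abs_max_sub_max_le_abs _ _ _).trans ?_
      simpa [Real.dist_eq] using hlip.dist_le_mul x hx y hy
    · simpa using hsph z hz
  have hcrit {x : Pt} (hx : h x = 0) := lineDeriv_eq_zero_of_nonneg hh0 hx
  have hJ := integral_jacobian_eq_zero hξ hξc hL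
    (EuclideanSpace.single 0 1) (EuclideanSpace.single 1 1)
  have hae : (fun x ↦ ω x * (pderiv2 0 ξ x * pderiv2 1 ψ x - pderiv2 1 ξ x * pderiv2 0 ψ x))
      =ᵐ[volume.restrict D] fun x ↦ lam *
        (fderiv ℝ ξ x (EuclideanSpace.single 0 1) * lineDeriv ℝ h x (EuclideanSpace.single 1 1) -
        fderiv ℝ ξ x (EuclideanSpace.single 1 1) *
          lineDeriv ℝ h x (EuclideanSpace.single 0 1)) := by
    filter_upwards [hoffU, ae_restrict_of_ae hc,
      ae_restrict_of_ae hL.ae_differentiableAt] with x hxoff hxc hxd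
    by_cases hxU : x ∈ U
    · have hnear : h =ᶠ[𝓝 x] fun y ↦ max (ψ y - c) 0 := by
        filter_upwards [hUo.mem_nhds hxU] with y hy using indicator_of_mem (hUB hy) _
      have hxψ := hψd x (hUD hxU)
      rcases lt_trichotomy (ψ x) c with hlt | heq | hgt
      · have : h x = 0 := by rw [hnear.eq_of_nhds, max_eq_right (by linarith)]
        simp [hcrit this, (hxc hxU).1 hlt]
      · have hx0 : h x = 0 := by rw [hnear.eq_of_nhds, max_eq_right (by linarith)]
        have hmin : IsLocalMin (fun y ↦ h y - ψ y) x := by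
          filter_upwards [hnear] with y hy
          rw [hy, hx0, heq]
          linarith [le_max_left (ψ y - c) 0]
        have h1 := hmin.fderiv_eq_zero
        have h2 : fderiv ℝ h x = 0 :=
          IsLocalMin.fderiv_eq_zero (.of_forall fun y ↦ by simpa [hx0] using hh0 y)
        rw [fderiv_fun_sub hxd hxψ, h2, zero_sub, neg_eq_zero] at h1
        simp [hcrit hx0, pderiv2, h1]
      · have hnear' : h =ᶠ[𝓝 x] fun y ↦ ψ y - c := by
          filter_upwards [hnear, hxψ.continuousAt.eventually (lt_mem_nhds hgt)] with y hy hy'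
          rw [hy, max_eq_left (by linarith)]
        have hder (v : Pt) : lineDeriv ℝ h x v = fderiv ℝ ψ x v := by
          rw [hxd.lineDeriv_eq_fderiv, hnear'.fderiv_eq, fderiv_sub_const]
        simp only [hder, (hxc hxU).2 hgt, pderiv2]
    · have : h x = 0 := by
        by_cases hxB : x ∈ B
        · have hxs : x ∈ sphere x₀ δ := le_antisymm hxB (not_lt.1 hxU)
          rw [hh, indicator_of_mem hxB, max_eq_right (by linarith [hsph x hxs])]
        · exact indicator_of_notMem hxB _
      simp [hcrit this, hxoff hxU]
  refine ⟨(hJ.1.integrableOn.const_mul lam).congr hae.symm, ?_⟩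
  rw [integral_congr_ae hae, integral_const_mul, setIntegral_eq_integral_of_forall_compl_eq_zero,
    hJ.2, mul_zero]
  intro x hx
  have : h x = 0 := indicator_of_notMem (fun hxB ↦ hx (hBD hxB)) _
  simp [hcrit this]

lemma integrable_kernel_mul {α : Type*} [MeasurableSpace α] {μ : Measure α} [SFinite μ]
    {G : α → α → ℝ} (hG : Integrable (fun p : α × α ↦ G p.1 p.2) (μ.prod μ)) {f g : α → ℝ}
    {A B : ℝ} (hf : Measurable f) (hg : Measurable g) (hfA : ∀ᵐ x ∂μ, |f x| ≤ A)
    (hgB : ∀ᵐ x ∂μ, |g x| ≤ B) :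
    Integrable (fun p : α × α ↦ G p.1 p.2 * f p.1 * g p.2) (μ.prod μ) :=
  (hG.mul_bdd (hf.comp measurable_fst).aestronglyMeasurable
    (Measure.quasiMeasurePreserving_fst.ae hfA)).mul_bdd
    (hg.comp measurable_snd).aestronglyMeasurable (Measure.quasiMeasurePreserving_snd.ae hgB)

/-- First variation of a quadratic energy with symmetric kernel along a segment on which the
initial point is maximal. -/
lemma first_variation_nonpos {α : Type*} [MeasurableSpace α] {μ : Measure α} [SFinite μ]
    {G : α → α → ℝ} (hG : Integrable (fun p : α × α ↦ G p.1 p.2) (μ.prod μ))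
    (hGsym : ∀ x y, G x y = G y x) {w η : α → ℝ} {A B : ℝ} (hw : Measurable w)
    (hη : Measurable η) (hwA : ∀ᵐ x ∂μ, |w x| ≤ A) (hηB : ∀ᵐ x ∂μ, |η x| ≤ B)
    (hmax : ∀ s ∈ Icc (0 : ℝ) 1,
      ∫ x, ∫ y, G x y * (w x + s * η x) * (w y + s * η y) ∂μ ∂μ ≤
        ∫ x, ∫ y, G x y * w x * w y ∂μ ∂μ) :
    ∫ x, (∫ y, G x y * w y ∂μ) * η x ∂μ ≤ 0 := by
  have iww := integrable_kernel_mul hG hw hw hwA hwA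
  have iwη := integrable_kernel_mul hG hw hη hwA hηB
  have iηw := integrable_kernel_mul hG hη hw hηB hwA
  have iηη := integrable_kernel_mul hG hη hη hηB hηB
  have hsym : ∫ p : α × α, G p.1 p.2 * w p.1 * η p.2 ∂(μ.prod μ) =
      ∫ p : α × α, G p.1 p.2 * η p.1 * w p.2 ∂(μ.prod μ) := by
    rw [← integral_prod_swap]
    refine integral_congr_ae (.of_forall fun p ↦ ?_)
    simp only [Prod.fst_swap, Prod.snd_swap]
    rw [hGsym]; ring
  have hlin : ∫ x, (∫ y, G x y * w y ∂μ) * η x ∂μ =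
      ∫ p : α × α, G p.1 p.2 * η p.1 * w p.2 ∂(μ.prod μ) := by
    rw [integral_prod _ iηw]
    refine integral_congr_ae (.of_forall fun x ↦ ?_)
    simp only
    rw [← integral_mul_const]
    refine integral_congr_ae (.of_forall fun y ↦ ?_)
    simp only
    ring
  rw [hlin]
  set I := ∫ p : α × α, G p.1 p.2 * η p.1 * w p.2 ∂(μ.prod μ)
  set Q := ∫ p : α × α, G p.1 p.2 * η p.1 * η p.2 ∂(μ.prod μ)
  have hexp (s : ℝ) : ∫ x, ∫ y, G x y * (w x + s * η x) * (w y + s * η y) ∂μ ∂μ =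
      (∫ x, ∫ y, G x y * w x * w y ∂μ ∂μ) + 2 * s * I + s ^ 2 * Q := by
    have e : (fun p : α × α ↦ G p.1 p.2 * (w p.1 + s * η p.1) * (w p.2 + s * η p.2)) =
        fun p ↦ ((G p.1 p.2 * w p.1 * w p.2 + s * (G p.1 p.2 * w p.1 * η p.2)) +
          s * (G p.1 p.2 * η p.1 * w p.2)) + s ^ 2 * (G p.1 p.2 * η p.1 * η p.2) := by
      ext p; ring
    have i2 := iww.fun_add (iwη.const_mul s)
    have i3 := i2.fun_add (iηw.const_mul s)
    have i4 := i3.fun_add (iηη.const_mul (s ^ 2))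
    rw [← integral_prod _ iww, ← integral_prod
      (fun p : α × α ↦ G p.1 p.2 * (w p.1 + s * η p.1) * (w p.2 + s * η p.2))
      (by rw [e]; exact i4), e]
    rw [integral_add i3 (iηη.const_mul _), integral_add i2 (iηw.const_mul _),
      integral_add iww (iwη.const_mul _), integral_const_mul, integral_const_mul,
      integral_const_mul, hsym]
    ring
  by_contra! hI
  set s := I / (I + |Q|) with hs
  have hQ := abs_nonneg Q
  have hs0 : 0 < s := by positivity
  have hs1 : s ≤ 1 := (div_le_one (by positivity)).2 (by linarith)
  have h1 := hmax s ⟨hs0.le, hs1⟩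
  rw [hexp] at h1
  have h2 : s * (I + |Q|) = I := by rw [hs]; field_simp
  have h3 : 2 * I + s * Q ≤ 0 := by
    by_contra! h3
    nlinarith [mul_pos hs0 h3]
  nlinarith [neg_abs_le Q, mul_nonneg hs0.le (by linarith [neg_abs_le Q] : 0 ≤ |Q| + Q),
    mul_pos hs0 hI]

theorem stmt13
    (D : Set Pt) (hDo : IsOpen D) (hDb : Bornology.IsBounded D)
    (xb1 xb2 : Pt) (hx : xb1 ≠ xb2) (δ : ℝ) (hδ : 0 < δ)
    (hB1D : closedBall xb1 δ ⊆ D) (hB2D : closedBall xb2 δ ⊆ D)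
    (hBdisj : Disjoint (closedBall xb1 δ) (closedBall xb2 δ))
    (κ1 κ2 : ℝ) (hκ1 : 0 < κ1) (hκ2 : κ2 < 0)
    (G : Pt → Pt → ℝ)
    (hG : IntegrableOn (fun p : Pt × Pt => G p.1 p.2) (D ×ˢ D))
    (hGsym : ∀ x y, G x y = G y x)
    (lam : ℝ) (hlam : 0 < lam)
    (ω1 ω2 : Pt → ℝ)
    (hadm : IsAdmissiblePair D (closedBall xb1 δ) (closedBall xb2 δ) κ1 κ2 lam ω1 ω2)
    (hmax : ∀ ω, InK D (closedBall xb1 δ) (closedBall xb2 δ) κ1 κ2 lam ω →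
      energy D G ω ≤ energy D G (ω1 + ω2))
    (ψ : Pt → ℝ) (hψdef : ∀ x, ψ x = ∫ y in D, G x y * (ω1 y + ω2 y))
    (hψC1 : ContDiffOn ℝ 1 ψ D)
    (d : ℝ) (hd : 0 < d)
    (hdist1 : ∀ x ∈ Function.support ω1, ∀ y ∈ sphere xb1 δ, d ≤ dist x y)
    (hdist2 : ∀ x ∈ Function.support ω2, ∀ y ∈ sphere xb2 δ, d ≤ dist x y) :
    ∀ ξ : Pt → ℝ, ContDiff ℝ (⊤ : ℕ∞) ξ → HasCompactSupport ξ → tsupport ξ ⊆ D →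
      (∫ x in D, (ω1 x + ω2 x) *
        (pderiv2 0 ξ x * pderiv2 1 ψ x - pderiv2 1 ξ x * pderiv2 0 ψ x)) = 0 := by
  intro ξ hξ hξc _
  obtain ⟨hm1, hm2, hb1, hb2, hi1, hi2, ho1, ho2⟩ := hadm
  have hG' : Integrable (fun p : Pt × Pt ↦ G p.1 p.2)
      ((volume.restrict D).prod (volume.restrict D)) := by
    rwa [Measure.prod_restrict, ← Measure.volume_eq_prod]
  have hDfin : IsFiniteMeasure (volume.restrict D : Measure Pt) :=
    isFiniteMeasure_restrict.2 hDb.measure_lt_top.ne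
  have int1 : IntegrableOn ω1 D := Integrable.of_bound hm1.aestronglyMeasurable lam <| by
    filter_upwards [hb1] with x hx
    exact abs_le.2 ⟨by linarith, hx.2⟩
  have int2 : IntegrableOn ω2 D := Integrable.of_bound hm2.aestronglyMeasurable lam <| by
    filter_upwards [hb2] with x hx
    exact abs_le.2 ⟨hx.1, by linarith⟩
  have hwb : ∀ᵐ x ∂(volume.restrict D), |ω1 x + ω2 x| ≤ lam := by
    filter_upwards [hb1, hb2] with x h1 h2
    exact abs_le.2 ⟨by linarith, by linarith⟩
  have variation (η : Pt → ℝ) (hη : Measurable η)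
      (hηb : ∀ᵐ x ∂(volume.restrict D), |η x| ≤ lam)
      (hK : ∀ s ∈ Icc (0 : ℝ) 1, InK D (closedBall xb1 δ) (closedBall xb2 δ) κ1 κ2 lam
        fun x ↦ ω1 x + ω2 x + s * η x) : ∫ x in D, ψ x * η x ≤ 0 := by
    have := first_variation_nonpos hG' hGsym (w := fun x ↦ ω1 x + ω2 x) (hm1.add hm2) hη hwb hηb
      fun s hs ↦ by
        have := hmax _ (hK s hs)
        simp only [energy, Pi.add_apply] at this
        linarith
    simpa only [hψdef] using this
  have hJ1 := integral_jacobian_of_maximizer (ξ := ξ) hDo hδ hB1D hlam hd hm1 hb1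
    (by rwa [hi1]) ho1 hdist1 hψC1 (fun η hη hηB hηb hη0 ↦ by
      have hηabs : ∀ᵐ x ∂(volume.restrict D), |η x| ≤ lam := by
        filter_upwards [hb1, hηb] with x h1 h2
        exact abs_le.2 ⟨by linarith, by linarith⟩
      have hηi : IntegrableOn η D := Integrable.of_bound hη.aestronglyMeasurable lam hηabs
      refine variation η hη hηabs fun s hs ↦ ⟨fun x ↦ ω1 x + s * η x, ω2,
        .of_forall fun x ↦ by simp only [Pi.add_apply]; ring,
        hm1.add (hη.const_mul s), hm2, ?_, hb2, ?_, hi2, ?_, ho2⟩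
      · filter_upwards [hb1, hηb] with x h1 h2
        constructor <;> nlinarith [hs.1, hs.2]
      · rw [integral_add int1 (hηi.const_mul s), integral_const_mul, hη0, hi1]
        ring
      · filter_upwards [ho1] with x hx hxB
        rw [hx hxB, hηB x hxB]
        ring) hξ hξc
  have hJ2 := integral_jacobian_of_maximizer (ω := fun x ↦ -ω2 x) (ψ := fun x ↦ -ψ x)
    (ξ := ξ) (lam := lam) hDo hδ hB2D hlam hd hm2.neg
    (by filter_upwards [hb2] with x hx; constructor <;> linarith)
    (by rw [integral_neg, hi2]; linarith)
    (by filter_upwards [ho2] with x hx hxB; rw [hx hxB, neg_zero])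
    (fun x hx ↦ hdist2 x (by simpa using hx)) hψC1.neg (fun η hη hηB hηb hη0 ↦ by
      have hηabs : ∀ᵐ x ∂(volume.restrict D), |-η x| ≤ lam := by
        filter_upwards [hb2, hηb] with x h1 h2
        exact abs_le.2 ⟨by linarith, by linarith⟩
      have hηi : IntegrableOn (fun x ↦ -η x) D :=
        Integrable.of_bound hη.neg.aestronglyMeasurable lam hηabs
      have := variation (fun x ↦ -η x) hη.neg hηabs fun s hs ↦ ⟨ω1, fun x ↦ ω2 x + s * -η x,
        .of_forall fun x ↦ by simp only [Pi.add_apply]; ring,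
        hm1, hm2.add (hη.neg.const_mul s), hb1, ?_, hi1, ?_, ho1, ?_⟩
      · simpa using this
      · filter_upwards [hb2, hηb] with x h1 h2
        constructor <;> nlinarith [hs.1, hs.2]
      · rw [integral_add int2 (hηi.const_mul s), integral_const_mul, integral_neg, hη0, hi2]
        ring
      · filter_upwards [ho2] with x hx hxB
        rw [hx hxB, hηB x hxB]
        ring) hξ hξc
  have hneg (i : Fin 2) (x : Pt) : pderiv2 i (fun x ↦ -ψ x) x = -pderiv2 i ψ x := by
    simp [pderiv2, fderiv_fun_neg]
  have e : (fun x ↦ -ω2 x * (pderiv2 0 ξ x * pderiv2 1 (fun x ↦ -ψ x) x -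
      pderiv2 1 ξ x * pderiv2 0 (fun x ↦ -ψ x) x)) =
      fun x ↦ ω2 x * (pderiv2 0 ξ x * pderiv2 1 ψ x - pderiv2 1 ξ x * pderiv2 0 ψ x) := by
    ext x
    rw [hneg, hneg]
    ring
  rw [e] at hJ2
  simp_rw [add_mul]
  rw [integral_add hJ1.1 hJ2.1, hJ1.2, hJ2.2, add_zero]
end
end

section
/- Let (X, μ) be a measure space, ψ : X → ℝ measurable and integrable on sets of finite measure, and ν ∈ ℝ. Let A ⊆ X be a measurable set of finite measure with μ(A) = μ({x ∈ X : ψ(x) > ν}) < ∞. Then ∫_{{ψ > ν}} ψ dμ ≥ ∫_A ψ dμ; that is, among all measurable sets of the prescribed measure, the super-level set {ψ > ν} maximizes the integral of ψ. -/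
open MeasureTheory Set

theorem stmt14
    {X : Type*} [MeasurableSpace X] (μ : Measure X)
    (ψ : X → ℝ) (hψ : Measurable ψ)
    (hint : ∀ s : Set X, MeasurableSet s → μ s < ⊤ → IntegrableOn ψ s μ)
    (ν : ℝ) (A : Set X) (hA : MeasurableSet A) (hAfin : μ A < ⊤)
    (hmeas : μ A = μ {x | ν < ψ x}) :
    (∫ x in A, ψ x ∂μ) ≤ ∫ x in {x | ν < ψ x}, ψ x ∂μ := by
  set S : Set X := {x | ν < ψ x} with hS_def
  have hS : MeasurableSet S := measurableSet_lt measurable_const hψ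
  have hSfin : μ S < ⊤ := hmeas ▸ hAfin
  have hAS : μ (A \ S) < ⊤ := (measure_mono sdiff_subset).trans_lt hAfin
  have hSA : μ (S \ A) < ⊤ := (measure_mono sdiff_subset).trans_lt hSfin
  have hdiff : μ.real (A \ S) = μ.real (S \ A) := by
    have h₁ := measureReal_inter_add_sdiff (μ := μ) (s := A) hS hAfin.ne
    have h₂ := measureReal_inter_add_sdiff (μ := μ) (s := S) hA hSfin.ne
    have h₃ : μ.real A = μ.real S := congrArg ENNReal.toReal hmeas
    rw [inter_comm] at h₂
    linarith
  have upper : ∫ x in A \ S, ψ x ∂μ ≤ ν * μ.real (A \ S) := by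
    calc ∫ x in A \ S, ψ x ∂μ ≤ ∫ _ in A \ S, ν ∂μ :=
          setIntegral_mono_on (hint _ (hA.diff hS) hAS) (integrableOn_const hAS.ne)
            (hA.diff hS) fun x hx => not_lt.mp hx.2
      _ = ν * μ.real (A \ S) := by rw [setIntegral_const, smul_eq_mul, mul_comm]
  have lower : ν * μ.real (S \ A) ≤ ∫ x in S \ A, ψ x ∂μ := by
    calc ν * μ.real (S \ A) = ∫ _ in S \ A, ν ∂μ := by
          rw [setIntegral_const, smul_eq_mul, mul_comm]
      _ ≤ ∫ x in S \ A, ψ x ∂μ :=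
          setIntegral_mono_on (integrableOn_const hSA.ne) (hint _ (hS.diff hA) hSA)
            (hS.diff hA) fun x hx => le_of_lt hx.1
  rw [← integral_inter_add_sdiff hS (hint A hA hAfin),
    ← integral_inter_add_sdiff hA (hint S hS hSfin), inter_comm S A]
  rw [hdiff] at upper
  linarith
end

section
/- Assume G ∈ L¹(D × D) is symmetric (G(x,y) = G(y,x)) and positive semidefinite as a kernel: ∫_D∫_D G(x,y) u(x) u(y) dx dy ≥ 0 for every bounded measurable u on D. Let λ > 0, let A₁, A₂ ⊆ D be disjoint measurable sets, set ω = λ(1_{A₁} − 1_{A₂}) and ψ(x) = ∫_D G(x,y) ω(y) dy, and suppose ν₁, ν₂ ∈ ℝ satisfy |{x ∈ D : ψ(x) > ν₁}| = |A₁| and |{x ∈ D : ψ(x) < −ν₂}| = |A₂|. Then the rearranged patch ω̄ = λ(1_{{ψ > ν₁}} − 1_{{ψ < −ν₂}}) satisfies E(ω̄) ≥ E(ω). -/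
open MeasureTheory Metric Set Filter Topology Real

noncomputable section

section Kernel

variable {α : Type*} [MeasurableSpace α] {μ : Measure α}

theorem integrable_kernel_mul_mul [SFinite μ] {G : α → α → ℝ}
    (hG : Integrable (fun p : α × α => G p.1 p.2) (μ.prod μ)) {u v : α → ℝ}
    (hu : AEStronglyMeasurable u μ) (hv : AEStronglyMeasurable v μ)
    {M N : ℝ} (hM : ∀ x, |u x| ≤ M) (hN : ∀ x, |v x| ≤ N) :
    Integrable (fun p : α × α => G p.1 p.2 * u p.1 * v p.2) (μ.prod μ) := by
  have h1 : Integrable (fun p : α × α => G p.1 p.2 * u p.1) (μ.prod μ) :=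
    hG.mul_bdd hu.comp_fst (Eventually.of_forall fun p => hM p.1)
  exact h1.mul_bdd hv.comp_snd (Eventually.of_forall fun p => hN p.2)

theorem integral_kernel_le_of_integral_mul_nonneg [SFinite μ] {G : α → α → ℝ}
    (hG : Integrable (fun p : α × α => G p.1 p.2) (μ.prod μ))
    (hsymm : ∀ x y, G x y = G y x)
    (hpsd : ∀ u : α → ℝ, Measurable u → (∃ M, ∀ x, |u x| ≤ M) →
      0 ≤ ∫ x, ∫ y, G x y * u x * u y ∂μ ∂μ)
    {u v : α → ℝ} (hu : AEStronglyMeasurable u μ) (hv : AEStronglyMeasurable v μ)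
    {M N : ℝ} (hM : ∀ x, |u x| ≤ M) (hN : ∀ x, |v x| ≤ N)
    (huv : 0 ≤ ∫ x, (v x - u x) * ∫ y, G x y * u y ∂μ ∂μ) :
    ∫ x, ∫ y, G x y * u x * u y ∂μ ∂μ ≤ ∫ x, ∫ y, G x y * v x * v y ∂μ ∂μ := by
  have hw : AEStronglyMeasurable (fun x => v x - u x) μ := hv.sub hu
  have hwb : ∀ x, |v x - u x| ≤ N + M := fun x =>
    (abs_sub _ _).trans (add_le_add (hN x) (hM x))
  have hpos : 0 ≤ ∫ x, ∫ y, G x y * (v x - u x) * (v y - u y) ∂μ ∂μ := by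
    set w : α → ℝ := fun x => max (-(N + M)) (min (hw.mk _ x) (N + M)) with hw_def
    have hwm : Measurable w :=
      measurable_const.max (hw.stronglyMeasurable_mk.measurable.min measurable_const)
    have hwe : ∀ᵐ x ∂μ, v x - u x = w x := by
      filter_upwards [hw.ae_eq_mk] with x hx
      have := abs_le.1 (hwb x)
      simp only [hw_def, ← hx]
      rw [min_eq_left this.2, max_eq_right this.1]
    refine (hpsd w hwm ⟨N + M, fun x => ?_⟩).trans_eq ?_
    · have : 0 ≤ N + M := (abs_nonneg _).trans (hwb x)
      exact abs_le.2 ⟨le_max_left _ _, max_le (by linarith) (min_le_right _ _)⟩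
    · refine integral_congr_ae ?_
      filter_upwards [hwe] with x hx
      refine integral_congr_ae ?_
      filter_upwards [hwe] with y hy
      rw [hx, hy]
  have huu := integrable_kernel_mul_mul hG hu hu hM hM
  have hvv := integrable_kernel_mul_mul hG hv hv hN hN
  have hwu := integrable_kernel_mul_mul hG hw hu hwb hM
  have huw := integrable_kernel_mul_mul hG hu hw hM hwb
  have hww := integrable_kernel_mul_mul hG hw hw hwb hwb
  have hswap : ∫ p, G p.1 p.2 * u p.1 * (v p.2 - u p.2) ∂(μ.prod μ)
      = ∫ p, G p.1 p.2 * (v p.1 - u p.1) * u p.2 ∂(μ.prod μ) := by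
    rw [← integral_prod_swap]
    refine integral_congr_ae (Eventually.of_forall fun p => ?_)
    simp only [Prod.fst_swap, Prod.snd_swap]
    rw [hsymm p.2 p.1]
    ring
  have hcross : 0 ≤ ∫ p, G p.1 p.2 * (v p.1 - u p.1) * u p.2 ∂(μ.prod μ) := by
    rw [integral_prod _ hwu]
    refine huv.trans_eq (integral_congr_ae (Eventually.of_forall fun x => ?_))
    simp only
    rw [← integral_const_mul]
    refine integral_congr_ae (Eventually.of_forall fun y => ?_)
    simp only
    ring
  rw [← integral_prod _ hww] at hpos
  rw [← integral_prod _ huu, ← integral_prod _ hvv]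
  have hsum : ∫ p, G p.1 p.2 * v p.1 * v p.2 ∂(μ.prod μ)
      = ∫ p, G p.1 p.2 * u p.1 * u p.2 ∂(μ.prod μ)
        + ∫ p, G p.1 p.2 * (v p.1 - u p.1) * u p.2 ∂(μ.prod μ)
        + ∫ p, G p.1 p.2 * u p.1 * (v p.2 - u p.2) ∂(μ.prod μ)
        + ∫ p, G p.1 p.2 * (v p.1 - u p.1) * (v p.2 - u p.2) ∂(μ.prod μ) := by
    rw [← integral_add huu hwu, ← integral_add (f := fun p : α × α => _ + _) (huu.add hwu) huw,
      ← integral_add (f := fun p : α × α => _ + _) ((huu.add hwu).add huw) hww]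
    refine integral_congr_ae (Eventually.of_forall fun p => ?_)
    ring
  linarith

theorem integrable_indicator_sub_mul {f : α → ℝ} (hf : Integrable f μ) {s t : Set α}
    (hs : NullMeasurableSet s μ) (ht : NullMeasurableSet t μ) :
    Integrable (fun x => (s.indicator 1 x - t.indicator 1 x) * f x) μ := by
  refine ((hf.indicator₀ hs).sub (hf.indicator₀ ht)).congr (Eventually.of_forall fun x => ?_)
  by_cases h1 : x ∈ s <;> by_cases h2 : x ∈ t <;> simp [h1, h2]

/-- Among sets of a given measure, superlevel sets of `f` maximise the integral of `f`. -/
theorem integral_superlevel_indicator_sub_mul_nonneg [IsFiniteMeasure μ] {f : α → ℝ}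
    (hf : Integrable f μ) {s t : Set α} (hs : NullMeasurableSet s μ)
    (ht : NullMeasurableSet t μ) (hst : μ s = μ t) {c : ℝ}
    (hsc : ∀ᵐ x ∂μ, x ∈ s ↔ c < f x) :
    0 ≤ ∫ x, (s.indicator 1 x - t.indicator 1 x) * f x ∂μ := by
  have hc : ∫ x, (s.indicator 1 x - t.indicator 1 x) * c ∂μ = 0 := by
    have h1 : Integrable (s.indicator (1 : α → ℝ)) μ := (integrable_const 1).indicator₀ hs
    have h2 : Integrable (t.indicator (1 : α → ℝ)) μ := (integrable_const 1).indicator₀ ht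
    rw [integral_mul_const, integral_sub h1 h2, integral_indicator₀ hs, integral_indicator₀ ht]
    simp [Measure.real, hst]
  have hnn : 0 ≤ ∫ x, ((s.indicator 1 x - t.indicator 1 x) * f x
      - (s.indicator 1 x - t.indicator 1 x) * c) ∂μ := by
    refine integral_nonneg_of_ae ?_
    filter_upwards [hsc] with x hx
    by_cases h1 : x ∈ s
    · have := hx.1 h1
      by_cases h2 : x ∈ t <;> simp [h1, h2, this.le]
    · have := not_lt.1 (mt hx.2 h1)
      by_cases h2 : x ∈ t <;> simp [h1, h2, this]
  rw [integral_sub (integrable_indicator_sub_mul hf hs ht)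
    (integrable_indicator_sub_mul (integrable_const c) hs ht), hc] at hnn
  simpa using hnn

theorem aestronglyMeasurable_const_mul_indicator_sub {s t : Set α}
    (hs : NullMeasurableSet s μ) (ht : NullMeasurableSet t μ) (c : ℝ) :
    AEStronglyMeasurable (fun x => c * (s.indicator 1 x - t.indicator 1 x)) μ :=
  ((aestronglyMeasurable_one.indicator₀ hs).sub
    (aestronglyMeasurable_one.indicator₀ ht)).const_mul c

end Kernel

theorem abs_const_mul_indicator_sub_le {α : Type*} (s t : Set α) (c : ℝ) (x : α) :
    |c * (s.indicator 1 x - t.indicator 1 x)| ≤ |c| := by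
  by_cases h1 : x ∈ s <;> by_cases h2 : x ∈ t <;> simp [h1, h2]

theorem stmt15
    (D : Set Pt) (hDo : IsOpen D) (hDb : Bornology.IsBounded D)
    (G : Pt → Pt → ℝ)
    (hG : IntegrableOn (fun p : Pt × Pt => G p.1 p.2) (D ×ˢ D))
    (hGsym : ∀ x y, G x y = G y x)
    (hGpsd : ∀ u : Pt → ℝ, Measurable u → (∃ M, ∀ x, |u x| ≤ M) →
      0 ≤ ∫ x in D, ∫ y in D, G x y * u x * u y)
    (lam : ℝ) (hlam : 0 < lam)
    (A1 A2 : Set Pt) (hA1 : MeasurableSet A1) (hA2 : MeasurableSet A2)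
    (hA1D : A1 ⊆ D) (hA2D : A2 ⊆ D) (hAdisj : Disjoint A1 A2)
    (ω : Pt → ℝ)
    (hω : ω = fun x => lam * (A1.indicator 1 x - A2.indicator 1 x))
    (ψ : Pt → ℝ) (hψ : ∀ x, ψ x = ∫ y in D, G x y * ω y)
    (ν1 ν2 : ℝ)
    (hν1 : volume {x ∈ D | ν1 < ψ x} = volume A1)
    (hν2 : volume {x ∈ D | ψ x < -ν2} = volume A2)
    (ωb : Pt → ℝ)
    (hωb : ωb = fun x =>
      lam * ({x ∈ D | ν1 < ψ x}.indicator 1 x - {x ∈ D | ψ x < -ν2}.indicator 1 x)) :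
    energy D G ω ≤ energy D G ωb := by
  set μ : Measure Pt := volume.restrict D with hμ
  have : IsFiniteMeasure μ := ⟨by simpa [hμ] using hDb.measure_lt_top⟩
  have hDm := hDo.measurableSet
  have hG' : Integrable (fun p : Pt × Pt => G p.1 p.2) (μ.prod μ) := by
    rwa [hμ, Measure.prod_restrict]
  have hωm : AEStronglyMeasurable ω μ := hω ▸
    aestronglyMeasurable_const_mul_indicator_sub hA1.nullMeasurableSet hA2.nullMeasurableSet lam
  have hωM : ∀ x, |ω x| ≤ |lam| := hω ▸ abs_const_mul_indicator_sub_le A1 A2 lam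
  have hψi : Integrable ψ μ := by
    have h : Integrable (fun p : Pt × Pt => G p.1 p.2 * ω p.2) (μ.prod μ) :=
      hG'.mul_bdd hωm.comp_snd (Eventually.of_forall fun p => hωM p.2)
    rw [funext hψ]
    exact h.integral_prod_left
  set B1 : Set Pt := {x ∈ D | ν1 < ψ x} with hB1
  set B2 : Set Pt := {x ∈ D | ψ x < -ν2} with hB2
  have hB1m : NullMeasurableSet B1 μ := hDm.nullMeasurableSet.inter
    (nullMeasurableSet_lt aemeasurable_const hψi.aemeasurable)
  have hB2m : NullMeasurableSet B2 μ := hDm.nullMeasurableSet.inter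
    (nullMeasurableSet_lt hψi.aemeasurable aemeasurable_const)
  have hres : ∀ s : Set Pt, s ⊆ D → μ s = volume s := fun s hs =>
    Measure.restrict_eq_self _ hs
  have hD : ∀ᵐ x ∂μ, x ∈ D := ae_restrict_mem hDm
  have h1 : 0 ≤ ∫ x, (B1.indicator 1 x - A1.indicator 1 x) * ψ x ∂μ := by
    refine integral_superlevel_indicator_sub_mul_nonneg hψi hB1m hA1.nullMeasurableSet
      ?_ (c := ν1) ?_
    · rw [hres _ (sep_subset _ _), hres _ hA1D, hν1]
    · filter_upwards [hD] with x hx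
      simp [hB1, hx]
  have h2 : 0 ≤ ∫ x, (B2.indicator 1 x - A2.indicator 1 x) * (-ψ) x ∂μ := by
    refine integral_superlevel_indicator_sub_mul_nonneg hψi.neg hB2m hA2.nullMeasurableSet
      ?_ (c := ν2) ?_
    · rw [hres _ (sep_subset _ _), hres _ hA2D, hν2]
    · filter_upwards [hD] with x hx
      simp [hB2, hx, lt_neg]
  refine mul_le_mul_of_nonneg_left ?_ (by norm_num)
  have hωbm : AEStronglyMeasurable ωb μ :=
    hωb ▸ aestronglyMeasurable_const_mul_indicator_sub hB1m hB2m lam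
  have hωbM : ∀ x, |ωb x| ≤ |lam| := hωb ▸ abs_const_mul_indicator_sub_le B1 B2 lam
  refine integral_kernel_le_of_integral_mul_nonneg hG' hGsym hGpsd hωm hωbm hωM hωbM ?_
  simp only [← hψ]
  have hsum := integral_add
    (integrable_indicator_sub_mul hψi hB1m hA1.nullMeasurableSet)
    (integrable_indicator_sub_mul hψi.neg hB2m hA2.nullMeasurableSet)
  refine (mul_nonneg hlam.le (hsum ▸ add_nonneg h1 h2)).trans_eq ?_
  rw [← integral_const_mul]
  refine integral_congr_ae (Eventually.of_forall fun x => ?_)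
  simp only [hω, hωb, Pi.neg_apply]
  ring
end
end
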